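/- arXiv:2204.11100 — 3 statements merged into one kernel-verified Lean document; each statement's English description precedes it below -/
import Mathlib

section
/- Let G be a finite connected simple graph with maximum degree Δ ≥ 3 that is not isomorphic to the complete graph K_{Δ+1}. Then G admits a proper vertex coloring with Δ colors. -/
namespace SimpleGraph

variable {V : Type*} {G : SimpleGraph V} {k : ℕ}

/-- `c` assigns distinct colors to adjacent vertices of `A`. -/
def IsProperOn {α : Type*} (G : SimpleGraph V) (c : V → α) (A : Finset V) : Prop :=
  ∀ u ∈ A, ∀ v ∈ A, G.Adj u v → c u ≠ c v

section Greedy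

variable [DecidableEq V]

theorem IsProperOn.update {α : Type*} {c : V → α} {A : Finset V} (hc : G.IsProperOn c A)
    {v : V} {a : α} (ha : ∀ u ∈ A, G.Adj v u → c u ≠ a) :
    G.IsProperOn (Function.update c v a) (insert v A) := by
  intro x hx y hy hxy
  have hne := hxy.ne
  have hxy' := hxy.symm
  rw [Finset.mem_insert] at hx hy
  by_cases h1 : x = v <;> by_cases h2 : y = v
  · exact absurd (h1.trans h2.symm) hne
  · subst h1
    simpa [h2] using (ha y (by tauto) hxy).symm
  · subst h2
    simpa [h1] using ha x (by tauto) hxy'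
  · simpa [h1, h2] using hc x (by tauto) y (by tauto) hxy

variable [Fintype V] [DecidableRel G.Adj]

theorem IsProperOn.exists_insert {c : V → Fin k} {A : Finset V} (hc : G.IsProperOn c A)
    {v : V} (hv : v ∉ A) (hcard : ((G.neighborFinset v ∩ A).image c).card < k) :
    ∃ c' : V → Fin k, G.IsProperOn c' (insert v A) ∧ ∀ u ∈ A, c' u = c u := by
  obtain ⟨a, -, ha⟩ := Finset.exists_mem_notMem_of_card_lt_card
    (s := (G.neighborFinset v ∩ A).image c) (t := Finset.univ) (by simpa using hcard)
  refine ⟨Function.update c v a, hc.update fun u hu huv h ↦ ha ?_, fun u hu ↦ ?_⟩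
  · exact Finset.mem_image.2 ⟨u, by simp [hu, huv], h⟩
  · exact Function.update_of_ne (by rintro rfl; exact hv hu) _ _

/-- A vertex with an uncolored neighbor can be colored. -/
theorem IsProperOn.exists_insert_of_adj_notMem {c : V → Fin k} {A : Finset V}
    (hc : G.IsProperOn c A) {v w : V} (hdeg : G.degree v ≤ k) (hv : v ∉ A) (hvw : G.Adj v w)
    (hw : w ∉ A) :
    ∃ c' : V → Fin k, G.IsProperOn c' (insert v A) ∧ ∀ u ∈ A, c' u = c u := by
  refine hc.exists_insert hv (Finset.card_image_le.trans_lt ?_)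
  refine lt_of_lt_of_le (Finset.card_lt_card (t := G.neighborFinset v) ?_) hdeg
  refine (Finset.ssubset_iff_of_subset Finset.inter_subset_left).2 ⟨w, by simpa using hvw, ?_⟩
  simp [hw]

/-- A vertex with two neighbors of the same color can be colored. -/
theorem IsProperOn.exists_insert_of_eq {c : V → Fin k} {A : Finset V}
    (hc : G.IsProperOn c A) {v x y : V} (hdeg : G.degree v ≤ k) (hv : v ∉ A)
    (hx : x ∈ A) (hy : y ∈ A) (hvx : G.Adj v x) (hvy : G.Adj v y) (hxy : x ≠ y)
    (h : c x = c y) :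
    ∃ c' : V → Fin k, G.IsProperOn c' (insert v A) ∧ ∀ u ∈ A, c' u = c u := by
  refine hc.exists_insert hv ?_
  have hle : (G.neighborFinset v ∩ A).card ≤ k :=
    (Finset.card_le_card Finset.inter_subset_left).trans hdeg
  refine lt_of_le_of_ne (Finset.card_image_le.trans hle) fun heq ↦ hxy ?_
  have hinj := Finset.card_image_iff.1 (le_antisymm Finset.card_image_le (hle.trans heq.ge))
  exact hinj (by simp [hx, hvx]) (by simp [hy, hvy]) h

/-- Greedy coloring along a path, up to its last vertex, which stays uncolored. -/
theorem IsProperOn.exists_union_path (hdeg : ∀ v, G.degree v ≤ k) {w : V} (L : List V)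
    {c : V → Fin k} {A : Finset V} (hc : G.IsProperOn c A)
    (hchain : (L ++ [w]).IsChain G.Adj) (hnodup : (L ++ [w]).Nodup)
    (hdisj : ∀ v ∈ L ++ [w], v ∉ A) :
    ∃ c' : V → Fin k, G.IsProperOn c' (A ∪ L.toFinset) ∧ ∀ u ∈ A, c' u = c u := by
  induction L generalizing c A with
  | nil => exact ⟨c, by simpa using hc, fun _ _ ↦ rfl⟩
  | cons v L ih =>
    rw [List.cons_append] at hchain hnodup hdisj
    obtain ⟨hv, hnodup'⟩ := List.nodup_cons.1 hnodup
    obtain ⟨z, T, hz⟩ := List.exists_cons_of_ne_nil (l := L ++ [w]) (by simp)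
    have hvz : G.Adj v z := by
      rw [hz] at hchain
      exact (List.isChain_cons_cons.1 hchain).1
    obtain ⟨c₁, hc₁, h₁⟩ := hc.exists_insert_of_adj_notMem (hdeg v)
      (hdisj v List.mem_cons_self) hvz (hdisj z (by simp [hz]))
    obtain ⟨c₂, hc₂, h₂⟩ := ih hc₁ hchain.tail hnodup' (by
      intro u hu
      rw [Finset.mem_insert, not_or]
      exact ⟨by rintro rfl; exact hv hu, hdisj u (List.mem_cons_of_mem _ hu)⟩)
    refine ⟨c₂, ?_, fun u hu ↦ ?_⟩
    · convert hc₂ using 1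
      ext
      simp
    · rw [h₂ u (Finset.mem_insert_of_mem hu), h₁ u hu]

/-- A coloring extends to a cycle having an edge `xw` such that `w` has a colored neighbor but
`x` has none. -/
theorem IsProperOn.exists_union_cycle (hdeg : ∀ v, G.degree v ≤ k) {x w u : V} {L : List V}
    {c : V → Fin k} {A : Finset V} (hc : G.IsProperOn c A)
    (hchain : (x :: (L ++ [w])).IsChain G.Adj) (hnodup : (x :: (L ++ [w])).Nodup)
    (hdisj : ∀ v ∈ x :: (L ++ [w]), v ∉ A) (hwx : G.Adj w x) (hx : ∀ v ∈ A, ¬ G.Adj x v)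
    (hu : u ∈ A) (hwu : G.Adj w u) :
    ∃ c' : V → Fin k, G.IsProperOn c' (A ∪ (x :: (L ++ [w])).toFinset) := by
  obtain ⟨hxL, hnodup'⟩ := List.nodup_cons.1 hnodup
  have hxA := hdisj x List.mem_cons_self
  have hux : u ≠ x := by rintro rfl; exact hxA hu
  have hc₁ := hc.update (v := x) (a := c u) fun v hv h ↦ absurd h (hx v hv)
  have hdisj₁ : ∀ v ∈ L ++ [w], v ∉ insert x A := by
    intro v hv
    rw [Finset.mem_insert, not_or]
    exact ⟨by rintro rfl; exact hxL hv, hdisj v (List.mem_cons_of_mem _ hv)⟩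
  obtain ⟨c₂, hc₂, h₂⟩ := hc₁.exists_union_path hdeg L hchain.tail hnodup' hdisj₁
  have hwL : w ∉ L := fun h ↦ (List.disjoint_of_nodup_append hnodup') h (by simp)
  obtain ⟨c₃, hc₃, -⟩ := hc₂.exists_insert_of_eq (v := w) (x := x) (y := u) (hdeg w)
    (by
      have := hdisj₁ w (by simp)
      simp only [Finset.mem_union, List.mem_toFinset]
      tauto)
    (by simp) (by simp [hu]) hwx hwu hux.symm
    (by rw [h₂ x (by simp), h₂ u (by simp [hu])]; simp [hux])
  refine ⟨c₃, ?_⟩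
  convert hc₃ using 1
  ext
  simp
  tauto

/-- A coloring extends to a path `N, z, M, p, q, r` with no colored neighbors such that `q` is
adjacent to `z`, while `p` and `r` are not adjacent. -/
theorem IsProperOn.exists_union_closed_path (hk : 0 < k) (hdeg : ∀ v, G.degree v ≤ k)
    {p q r z : V} {M N : List V} {c : V → Fin k} {A : Finset V} (hc : G.IsProperOn c A)
    (hchain : (N ++ z :: (M ++ [p, q, r])).IsChain G.Adj)
    (hnodup : (N ++ z :: (M ++ [p, q, r])).Nodup)
    (hdisj : ∀ v ∈ N ++ z :: (M ++ [p, q, r]), v ∉ A)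
    (hclosed : ∀ v ∈ N ++ z :: (M ++ [p, q, r]), ∀ u ∈ A, ¬ G.Adj v u)
    (hqz : G.Adj q z) (hpr : ¬ G.Adj p r) :
    ∃ c' : V → Fin k, G.IsProperOn c' (A ∪ (N ++ z :: (M ++ [p, q, r])).toFinset) := by
  let a : Fin k := ⟨0, hk⟩
  have hpr_ne : p ≠ r := by rintro rfl; simp [List.nodup_append] at hnodup
  have hc₁ := hc.update (v := r) (a := a) fun v hv h ↦ absurd h (hclosed r (by simp) v hv)
  have hc₂ := hc₁.update (v := p) (a := a) (by
    intro v hv h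
    rcases Finset.mem_insert.1 hv with rfl | hv
    · exact absurd h hpr
    · exact absurd h (hclosed p (by simp) v hv))
  have hMz : (M.reverse ++ [z]).IsChain G.Adj := by
    have h : (z :: M).IsChain G.Adj := hchain.infix ⟨N, [p, q, r], by simp⟩
    have := List.isChain_reverse.2 (h.imp fun _ _ h ↦ h.symm)
    simpa using this
  have hNz : (N ++ [z]).IsChain G.Adj := hchain.infix ⟨[], M ++ [p, q, r], by simp⟩
  have hNzq : ((N ++ [z]) ++ [q]).IsChain G.Adj := by
    refine hNz.append (by simp) ?_
    simpa using hqz.symm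
  have hqp : G.Adj q p := by
    have h : [p, q].IsChain G.Adj := hchain.infix ⟨N ++ z :: M, [r], by simp⟩
    simpa using (List.isChain_pair.1 h).symm
  have hqr : G.Adj q r := by
    have h : [q, r].IsChain G.Adj := hchain.infix ⟨N ++ z :: (M ++ [p]), [], by simp⟩
    simpa using h
  obtain ⟨c₃, hc₃, h₃⟩ := hc₂.exists_union_path hdeg M.reverse hMz
    (by grind) (by grind [List.mem_toFinset])
  obtain ⟨c₄, hc₄, h₄⟩ := hc₃.exists_union_path hdeg (N ++ [z]) hNzq
    (by grind) (by grind [List.mem_toFinset])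
  obtain ⟨c₅, hc₅, -⟩ := hc₄.exists_insert_of_eq (v := q) (x := p) (y := r) (hdeg q)
    (by grind [List.mem_toFinset]) (by simp) (by simp) hqp hqr hpr_ne
    (by
      rw [h₄ p (by simp), h₄ r (by simp), h₃ p (by simp), h₃ r (by simp)]
      simp [hpr_ne.symm])
  refine ⟨c₅, ?_⟩
  convert hc₅ using 1
  ext
  simp
  tauto

end Greedy

/-- Every path extends, at its head, to a maximal one. -/
theorem exists_maximal_path [Fintype V] (P : List V)
    (hchain : P.IsChain G.Adj) (hnodup : P.Nodup) :
    ∃ R, (R ++ P).IsChain G.Adj ∧ (R ++ P).Nodup ∧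
      ∀ t ∈ (R ++ P).head?, ∀ v, G.Adj t v → v ∈ R ++ P := by
  induction h : Fintype.card V - P.length using Nat.strong_induction_on generalizing P with
  | _ n ih =>
    by_cases hmax : ∀ t ∈ P.head?, ∀ v, G.Adj t v → v ∈ P
    · exact ⟨[], hchain, hnodup, hmax⟩
    · push Not at hmax
      obtain ⟨t, ht, v, hv, hvP⟩ := hmax
      have hnodup' : (v :: P).Nodup := List.nodup_cons.2 ⟨hvP, hnodup⟩
      have hlen := hnodup'.length_le_card
      rw [List.length_cons] at hlen
      obtain ⟨R, h₁, h₂, h₃⟩ := ih (Fintype.card V - (v :: P).length)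
        (by rw [List.length_cons]; omega) (v :: P)
        (List.isChain_cons.2 ⟨fun y hy ↦ by
          rw [Option.mem_unique hy ht]; exact hv.symm, hchain⟩) hnodup' rfl
      exact ⟨R ++ [v], by simpa using h₁, by simpa using h₂, by simpa using h₃⟩

end SimpleGraph

theorem List.exists_eq_append_first {α : Type*} (p : α → Prop) {l : List α}
    (h : ∃ a ∈ l, p a) : ∃ l₁ a l₂, l = l₁ ++ a :: l₂ ∧ p a ∧ ∀ b ∈ l₁, ¬ p b := by
  induction l with
  | nil => simp at h
  | cons x l ih =>
    by_cases hx : p x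
    · exact ⟨[], x, l, rfl, hx, by simp⟩
    · obtain ⟨l₁, a, l₂, rfl, ha, hl⟩ := ih (by simpa [hx] using h)
      exact ⟨x :: l₁, a, l₂, rfl, ha, by simpa [hx] using hl⟩

theorem List.exists_eq_append_last {α : Type*} (p : α → Prop) {l : List α}
    (h : ∃ a ∈ l, p a) : ∃ l₁ a l₂, l = l₁ ++ a :: l₂ ∧ p a ∧ ∀ b ∈ l₂, ¬ p b := by
  obtain ⟨l₁, a, l₂, hl, ha, hb⟩ := List.exists_eq_append_first p (l := l.reverse) (by simpa using h)
  refine ⟨l₂.reverse, a, l₁.reverse, ?_, ha, by simpa using hb⟩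
  rw [← List.reverse_reverse l, hl]
  simp

namespace SimpleGraph

variable {V : Type*} [Fintype V] [DecidableEq V] {G : SimpleGraph V} [DecidableRel G.Adj] {k : ℕ}

/-- In a graph without `k + 1`-cliques, a vertex of degree `k` has two nonadjacent neighbors. -/
theorem CliqueFree.exists_not_adj_of_degree_eq (hK : G.CliqueFree (k + 1)) {v : V}
    (hv : G.degree v = k) : ∃ p r, G.Adj v p ∧ G.Adj v r ∧ p ≠ r ∧ ¬ G.Adj p r := by
  by_contra! h
  refine hK (insert v (G.neighborFinset v)) ⟨?_, by simp [hv]⟩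
  rw [Finset.coe_insert, isClique_insert]
  refine ⟨fun p hp r hr hpr ↦ h p r (by simpa using hp) (by simpa using hr) hpr, ?_⟩
  intro u hu _
  simpa using hu

/-- Extension step for a nonempty set that spans a union of `k`-regular components. -/
theorem exists_isProperOn_of_closed (hk : 3 ≤ k) (hdeg : ∀ v, G.degree v ≤ k)
    (hK : G.CliqueFree (k + 1)) {s : Finset V} (hs : s.Nonempty)
    (hreg : ∀ v ∈ s, G.degree v = k) (hclosed : ∀ v ∈ s, ∀ u, G.Adj v u → u ∈ s)
    (ih : ∀ t ⊂ s, ∃ c : V → Fin k, G.IsProperOn c t) :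
    ∃ c : V → Fin k, G.IsProperOn c s := by
  obtain ⟨q, hq⟩ := hs
  obtain ⟨p, r, hqp, hqr, hpr_ne, hpr⟩ := hK.exists_not_adj_of_degree_eq (hreg q hq)
  obtain ⟨R, hchain, hnodup, hmax⟩ := exists_maximal_path (G := G) [p, q, r]
    (by simp [hqp.symm, hqr]) (by simp [hqp.ne', hqr.ne, hpr_ne])
  have hsub : ∀ v ∈ R ++ [p, q, r], v ∈ s := by
    have hR : ∀ v ∈ R, v ∈ s := by
      have hps := hclosed q hq p hqp
      clear hmax hnodup
      induction R with
      | nil => simp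
      | cons x R ihR =>
        have hR := ihR hchain.tail
        rw [List.cons_append, List.isChain_cons] at hchain
        refine List.forall_mem_cons.2 ⟨?_, hR⟩
        cases R with
        | nil => exact hclosed p hps x (hchain.1 p rfl).symm
        | cons y R => exact hclosed y (hR y (by simp)) x (hchain.1 y rfl).symm
    have := hclosed q hq
    grind
  set Q := R ++ [p, q, r] with hQ
  obtain ⟨t, T, hT⟩ := List.exists_cons_of_ne_nil (l := Q) (by simp [hQ])
  have hts : t ∈ s := hsub t (by simp [hT])
  have htQ : ∀ v, G.Adj t v → v ∈ Q := hmax t (by simp [hT])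
  obtain ⟨D, y, E, hD, hty, hE⟩ := List.exists_eq_append_last (G.Adj t) (l := T) (by
    obtain ⟨y, hy⟩ := (G.degree_pos_iff_exists_adj t).1 (by rw [hreg t hts]; omega)
    refine ⟨y, ?_, hy⟩
    simpa [hT, hy.ne'] using htQ y hy)
  have hQC : Q = (t :: (D ++ [y])) ++ E := by simp [hT, hD]
  set C := t :: (D ++ [y]) with hC
  have hCs : C.toFinset ⊆ s := fun v hv ↦
    hsub v (hQC ▸ List.mem_append_left E (List.mem_toFinset.1 hv))
  obtain ⟨c, hc⟩ := ih (s \ C.toFinset) (Finset.sdiff_ssubset hCs ⟨t, by simp [hC]⟩)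
  have hmem : ∀ v ∈ C, v ∉ s \ C.toFinset := by simp +contextual
  by_cases hout : ∃ w ∈ C, ∃ u ∈ s \ C.toFinset, G.Adj w u
  · obtain ⟨F, w, H, hF, ⟨u, hu, hwu⟩, hFout⟩ := List.exists_eq_append_first _ hout
    have htout : ¬ ∃ u ∈ s \ C.toFinset, G.Adj t u := by
      rintro ⟨u, hu, htu⟩
      have := htQ u htu
      have := hE u
      grind
    have hFne : F ≠ [] := by
      rintro rfl
      rw [List.nil_append, hC, List.cons.injEq] at hF
      exact htout ⟨u, hu, hF.1 ▸ hwu⟩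
    obtain ⟨F, x, rfl⟩ : ∃ F' x, F = F' ++ [x] :=
      ⟨_, _, (List.dropLast_append_getLast hFne).symm⟩
    have hCchain : C.IsChain G.Adj := hchain.infix ⟨[], E, by simp [hQC]⟩
    have hCnodup : C.Nodup := (List.nodup_append.1 (hQC ▸ hnodup)).1
    have hperm : (x :: ((F.reverse ++ H.reverse) ++ [w])).Perm C := by
      rw [hF]
      have := (List.reverse_perm (F ++ [x])).append (List.reverse_perm (w :: H))
      simpa using this
    have hxw : [x, w].IsChain G.Adj := hCchain.infix ⟨F, H, by simp [hF]⟩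
    have hcyc : (x :: ((F.reverse ++ H.reverse) ++ [w])).IsChain G.Adj := by
      have h₁ : (F ++ [x]).IsChain G.Adj := hCchain.infix ⟨[], w :: H, by simp [hF]⟩
      have h₂ : (w :: H).IsChain G.Adj := hCchain.infix ⟨F ++ [x], [], by simp [hF]⟩
      have h := (List.isChain_reverse.2 (h₁.imp fun _ _ h ↦ h.symm)).append
        (List.isChain_reverse.2 (h₂.imp fun _ _ h ↦ h.symm)) (by
          have e₁ : (F ++ [x]).head? = some t := by
            have : (F ++ [x]).head? = C.head? := by rw [hF]; cases F <;> rfl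
            rw [this, hC, List.head?_cons]
          have e₂ : (w :: H).getLast? = some y := by
            have : (w :: H).getLast? = C.getLast? := by
              rw [hF, List.getLast?_append_of_ne_nil _ (by simp)]
            rw [this, hC, ← List.cons_append, List.getLast?_concat]
          rw [List.getLast?_reverse, List.head?_reverse, e₁, e₂]
          simpa using hty)
      simpa using h
    obtain ⟨c', hc'⟩ := hc.exists_union_cycle hdeg hcyc (hperm.nodup_iff.2 hCnodup)
      (fun v hv ↦ hmem v (hperm.mem_iff.1 hv))
      (List.isChain_pair.1 hxw).symm (fun v hv h ↦ hFout x (by simp) ⟨v, hv, h⟩) hu hwu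
    rw [List.toFinset_eq_of_perm _ _ hperm, Finset.sdiff_union_of_subset hCs] at hc'
    exact ⟨c', hc'⟩
  · push Not at hout
    have hEnil : E = [] := by
      rcases E with _ | ⟨e, E⟩
      · rfl
      have hye : [y, e].IsChain G.Adj := hchain.infix ⟨t :: D, E, by simp [hQC, hC]⟩
      refine absurd (by simpa using hye) (hout y (by simp [hC]) e ?_)
      have heC : e ∉ C := fun h ↦
        List.disjoint_of_nodup_append (hQC ▸ hnodup : (C ++ e :: E).Nodup) h List.mem_cons_self
      simpa [heC] using hsub e (by simp [hQC])
    have hCQ : C = Q := by simp [hQC, hEnil]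
    rw [hCQ] at hout hmem hc hCs
    obtain ⟨z, hzq, hz⟩ : ∃ z ∈ G.neighborFinset q, z ∉ ({p, r} : Finset V) :=
      Finset.exists_mem_notMem_of_card_lt_card (by
        rw [card_neighborFinset_eq_degree, hreg q hq]
        exact Finset.card_le_two.trans_lt hk)
    rw [mem_neighborFinset] at hzq
    have hzQ : z ∈ Q := by
      by_contra hzQ
      exact hout q (by simp [hQ]) z (by simp [hzQ, hclosed q hq z hzq]) hzq
    have hzR : z ∈ R := by
      have := hzq.ne'
      simp_all
    obtain ⟨N, M, rfl⟩ := List.append_of_mem hzR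
    have hQ' : Q = N ++ z :: (M ++ [p, q, r]) := by simp [hQ]
    rw [hQ'] at hchain hnodup hout hmem hc hCs
    obtain ⟨c', hc'⟩ := hc.exists_union_closed_path (by omega) hdeg hchain hnodup hmem hout hzq hpr
    rw [Finset.sdiff_union_of_subset hCs] at hc'
    exact ⟨c', hc'⟩

/-- Brooks' theorem for graphs that are not necessarily connected. -/
theorem CliqueFree.colorable_of_degree_le (hK : G.CliqueFree (k + 1)) (hk : 3 ≤ k)
    (hdeg : ∀ v, G.degree v ≤ k) : G.Colorable k := by
  suffices h : ∀ s : Finset V, ∃ c : V → Fin k, G.IsProperOn c s by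
    obtain ⟨c, hc⟩ := h Finset.univ
    exact ⟨Coloring.mk c fun {u v} huv ↦ hc u (Finset.mem_univ u) v (Finset.mem_univ v) huv⟩
  intro s
  induction s using Finset.strongInduction with
  | H s ih =>
    rcases s.eq_empty_or_nonempty with rfl | hs
    · exact ⟨fun _ ↦ ⟨0, by omega⟩, by simp [IsProperOn]⟩
    by_cases hlow : ∃ v ∈ s, (G.neighborFinset v ∩ s).card < k
    · obtain ⟨v, hv, hlt⟩ := hlow
      obtain ⟨c, hc⟩ := ih (s.erase v) (Finset.erase_ssubset hv)
      obtain ⟨c', hc', -⟩ := hc.exists_insert (v := v) (by simp)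
        (Finset.card_image_le.trans_lt ((Finset.card_le_card
          (Finset.inter_subset_inter_left (Finset.erase_subset v s))).trans_lt hlt))
      exact ⟨c', by rwa [Finset.insert_erase hv] at hc'⟩
    · push Not at hlow
      have hsub : ∀ v ∈ s, G.neighborFinset v ∩ s = G.neighborFinset v := fun v hv ↦
        Finset.eq_of_subset_of_card_le Finset.inter_subset_left ((hdeg v).trans (hlow v hv))
      refine exists_isProperOn_of_closed hk hdeg hK hs (fun v hv ↦ ?_) (fun v hv u huv ↦ ?_) ih
      · exact le_antisymm (hdeg v) ((hlow v hv).trans_eq (by rw [hsub v hv]; rfl))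
      · have : u ∈ G.neighborFinset v ∩ s := by rw [hsub v hv]; simpa using huv
        exact (Finset.mem_inter.1 this).2

/-- A connected graph of maximum degree at most `k` with a `k + 1`-clique is complete. -/
theorem IsNClique.eq_univ_of_connected (hconn : G.Connected) (hdeg : ∀ v, G.degree v ≤ k)
    {S : Finset V} (hS : G.IsNClique (k + 1) S) : S = Finset.univ := by
  have hclosed : ∀ v ∈ S, ∀ u, G.Adj v u → u ∈ S := by
    intro v hv u huv
    have hsub : S.erase v ⊆ G.neighborFinset v := fun x hx ↦ by
      rw [Finset.mem_erase] at hx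
      simpa using hS.isClique hv hx.2 hx.1.symm
    have heq := Finset.eq_of_subset_of_card_le hsub
      ((hdeg v).trans_eq (by rw [Finset.card_erase_of_mem hv, hS.card_eq]; rfl))
    rw [← mem_neighborFinset, ← heq] at huv
    exact Finset.mem_of_mem_erase huv
  obtain ⟨v, hv⟩ : S.Nonempty := Finset.card_pos.1 (by rw [hS.card_eq]; omega)
  refine Finset.eq_univ_iff_forall.2 fun u ↦ ?_
  obtain ⟨W⟩ := hconn.preconnected v u
  induction W with
  | nil => exact hv
  | cons h _ ih => exact ih (hclosed _ hv _ h)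

end SimpleGraph

/-- **Brooks' Theorem.** Every finite connected simple graph with maximum degree
`Δ ≥ 3` that is not isomorphic to the complete graph `K_{Δ+1}` is `Δ`-colorable. -/
theorem brooks_theorem {V : Type*} [Fintype V] [DecidableEq V]
    (G : SimpleGraph V) [DecidableRel G.Adj]
    (hconn : G.Connected) (hΔ : 3 ≤ G.maxDegree)
    (hK : ¬ Nonempty (G ≃g (⊤ : SimpleGraph (Fin (G.maxDegree + 1))))) :
    G.Colorable G.maxDegree := by
  refine SimpleGraph.CliqueFree.colorable_of_degree_le (fun S hS ↦ hK ?_) hΔ G.degree_le_maxDegree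
  obtain rfl := hS.eq_univ_of_connected hconn G.degree_le_maxDegree
  refine ⟨⟨Fintype.equivFinOfCardEq hS.card_eq, fun {a b} ↦ ?_⟩⟩
  simp only [SimpleGraph.top_adj, ne_eq, EmbeddingLike.apply_eq_iff_eq]
  exact ⟨fun h ↦ hS.isClique (by simp) (by simp) h, fun h ↦ h.ne⟩
end

section
/- Let G be a finite connected simple graph with maximum degree Δ ≥ 3 that is not complete. Let s ≥ 2 and let p_1, ..., p_s ≥ 0 be integers such that p_1 + ⋯ + p_s ≥ Δ − s. Then the vertex set of G can be partitioned into sets V_1, ..., V_s such that for each i ∈ {1, ..., s} the induced subgraph G[V_i] is p_i-degenerate and has maximum degree at most p_i + 1. -/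
/-- `G[A]` is `d`-degenerate: every non-empty subgraph of the subgraph of `G`
induced by `A` contains a vertex of degree at most `d`.  Equivalently, every
non-empty `B ⊆ A` contains a vertex having at most `d` neighbors inside `B`. -/
def DegenerateOn {V : Type*} [DecidableEq V] (G : SimpleGraph V) [DecidableRel G.Adj]
    (A : Finset V) (d : ℕ) : Prop :=
  ∀ B : Finset V, B ⊆ A → B.Nonempty → ∃ v ∈ B, (B.filter (fun u => G.Adj v u)).card ≤ d

namespace BorodinBollobasManvel

section

variable {V : Type*} [DecidableEq V] {G : SimpleGraph V} [DecidableRel G.Adj]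

variable (G) in
/-- The number of neighbors of `v` in `S`. -/
def degIn (v : V) (S : Finset V) : ℕ := (S.filter (fun u => G.Adj v u)).card

variable (G) in
/-- `G[S]` is connected or empty: a non-empty subset of `S` closed under adjacency in `S` is
all of `S`. -/
def ConnOn (S : Finset V) : Prop :=
  ∀ U ⊆ S, U.Nonempty → (∀ x ∈ U, ∀ y ∈ S, G.Adj x y → y ∈ U) → S ⊆ U

omit [DecidableEq V] in
lemma degIn_mono (v : V) {S T : Finset V} (h : S ⊆ T) : degIn G v S ≤ degIn G v T :=
  Finset.card_le_card (Finset.filter_subset_filter _ h)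

lemma degIn_insert (v : V) {u : V} {S : Finset V} (hu : u ∉ S) :
    degIn G v (insert u S) = degIn G v S + if G.Adj v u then 1 else 0 := by
  unfold degIn
  rw [Finset.filter_insert]
  split_ifs
  · rw [Finset.card_insert_of_notMem (by simp [hu])]
  · rfl

lemma degIn_erase (v : V) {u : V} {S : Finset V} (hu : u ∈ S) :
    degIn G v S = degIn G v (S.erase u) + if G.Adj v u then 1 else 0 := by
  conv_lhs => rw [← Finset.insert_erase hu]
  exact degIn_insert v (Finset.notMem_erase u S)

lemma degIn_erase_self (v : V) (S : Finset V) : degIn G v (S.erase v) = degIn G v S := by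
  by_cases h : v ∈ S
  · simp [degIn_erase v h]
  · rw [Finset.erase_eq_of_notMem h]

lemma degIn_add_degIn_compl [Fintype V] (v : V) (S : Finset V) :
    degIn G v S + degIn G v Sᶜ = degIn G v Finset.univ := by
  unfold degIn
  rw [← Finset.card_union_of_disjoint, ← Finset.filter_union, Finset.union_compl]
  exact Finset.disjoint_filter_filter disjoint_compl_right

lemma _root_.DegenerateOn.mono {A B : Finset V} {d : ℕ} (h : DegenerateOn G B d) (hAB : A ⊆ B) :
    DegenerateOn G A d :=
  fun C hC hne => h C (hC.trans hAB) hne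

lemma _root_.DegenerateOn.insert_of_degIn_le {A : Finset V} {d : ℕ} {v : V} (h : DegenerateOn G A d)
    (hv : degIn G v A ≤ d) : DegenerateOn G (insert v A) d := by
  intro C hC hne
  by_cases hvC : v ∈ C
  · refine ⟨v, hvC, le_trans ?_ hv⟩
    refine Finset.card_le_card fun u hu => ?_
    simp only [Finset.mem_filter] at hu ⊢
    refine ⟨?_, hu.2⟩
    rcases Finset.mem_insert.1 (hC hu.1) with rfl | h'
    · exact absurd hu.2 (G.irrefl)
    · exact h'
  · refine h C (fun u hu => ?_) hne
    rcases Finset.mem_insert.1 (hC hu) with rfl | h'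
    · exact absurd hu hvC
    · exact h'

omit [DecidableEq V] [DecidableRel G.Adj] in
lemma ConnOn.forall_mem {S : Finset V} (h : ConnOn G S) (P : V → Prop) {x₀ : V} (hx₀ : x₀ ∈ S)
    (hP : P x₀) (step : ∀ x ∈ S, P x → ∀ y ∈ S, G.Adj x y → P y) : ∀ x ∈ S, P x := by
  classical
  intro x hx
  have := h (S.filter P) (Finset.filter_subset _ _) ⟨x₀, by simp [hx₀, hP]⟩ (by
    intro x hx y hy hxy
    simp only [Finset.mem_filter] at hx ⊢
    exact ⟨hy, step x hx.1 hx.2 y hy hxy⟩) hx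
  exact (Finset.mem_filter.1 this).2

omit [DecidableRel G.Adj] in
lemma ConnOn.insert_of_adj {S : Finset V} (h : ConnOn G S) {x y : V} (hx : x ∈ S) (hxy : G.Adj x y) :
    ConnOn G (insert y S) := by
  intro U hU hne hcl
  obtain ⟨u, hu⟩ := hne
  have hxU : x ∈ U := by
    rcases Finset.mem_insert.1 (hU hu) with rfl | huS
    · exact hcl u hu x (by simp [hx]) hxy.symm
    · exact h.forall_mem (fun z => u ∈ U → (z ∈ U)) huS id
        (fun a _ haU b hb hab hu => hcl a (haU hu) b (by simp [hb]) hab) x hx hu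
  intro z hz
  rcases Finset.mem_insert.1 hz with rfl | hzS
  · exact hcl x hxU z hz hxy
  · exact h.forall_mem (· ∈ U) hx hxU
      (fun a _ haU b hb hab => hcl a haU b (by simp [hb]) hab) z hzS

omit [DecidableRel G.Adj] in
lemma exists_component {S : Finset V} {v : V} (hv : v ∈ S) :
    ∃ C ⊆ S, v ∈ C ∧ ConnOn G C ∧ ∀ x ∈ C, ∀ y ∈ S, G.Adj x y → y ∈ C := by
  classical
  obtain ⟨C, hC, hmin⟩ := Finset.exists_min_image
    (S.powerset.filter fun C => v ∈ C ∧ ∀ x ∈ C, ∀ y ∈ S, G.Adj x y → y ∈ C) Finset.card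
    ⟨S, by simp only [Finset.mem_filter, Finset.mem_powerset]; exact ⟨le_rfl, hv, by tauto⟩⟩
  simp only [Finset.mem_filter, Finset.mem_powerset] at hC hmin
  obtain ⟨hCS, hvC, hcl⟩ := hC
  refine ⟨C, hCS, hvC, ?_, hcl⟩
  intro U hU hne hUcl
  by_cases hvU : v ∈ U
  · have := hmin U ⟨hU.trans hCS, hvU,
      fun x hx y hy hxy => hUcl x hx y (hcl x (hU hx) y hy hxy) hxy⟩
    exact (Finset.eq_of_subset_of_card_le hU this).ge
  · exfalso
    have := hmin (C \ U) ⟨Finset.sdiff_subset.trans hCS, by simp [hvC, hvU], by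
      intro x hx y hy hxy
      simp only [Finset.mem_sdiff] at hx ⊢
      exact ⟨hcl x hx.1 y hy hxy, fun hyU => hx.2 (hUcl y hyU x hx.1 hxy.symm)⟩⟩
    have h2 := Finset.card_lt_card (Finset.sdiff_ssubset hU hne)
    omega

omit [DecidableEq V] [DecidableRel G.Adj] in
lemma ConnOn.exists_adj {S : Finset V} (h : ConnOn G S) {v w : V} (hv : v ∈ S) (hw : w ∈ S)
    (hvw : v ≠ w) : ∃ y ∈ S, G.Adj v y := by
  by_contra! hno
  have := h {v} (by simpa using hv) (by simp) (by
    intro x hx y hy hxy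
    rw [Finset.mem_singleton] at hx
    exact absurd (hx ▸ hxy) (hno y hy)) hw
  exact hvw (Finset.mem_singleton.1 this).symm

omit [DecidableRel G.Adj] in
/-- A connected set has a vertex whose removal keeps it connected. -/
lemma ConnOn.exists_erase {S : Finset V} (h : ConnOn G S) (hne : S.Nonempty) :
    ∃ v ∈ S, ConnOn G (S.erase v) := by
  classical
  by_cases hS : ∃ v ∈ S, S.erase v = ∅
  · obtain ⟨v, hv, h0⟩ := hS
    exact ⟨v, hv, by rw [h0]; intro U hU; simp⟩
  push Not at hS
  obtain ⟨v₀, hv₀⟩ := hne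
  obtain ⟨C₀, hC₀, hconn₀⟩ : ∃ C ⊆ S.erase v₀, C.Nonempty ∧ ConnOn G C := by
    obtain ⟨x, hx⟩ := hS v₀ hv₀
    obtain ⟨C, hC, hxC, hconn, -⟩ := exists_component (G := G) hx
    exact ⟨C, hC, ⟨x, hxC⟩, hconn⟩
  obtain ⟨C, hC, hmax⟩ := Finset.exists_max_image
    (S.powerset.filter fun C => C.Nonempty ∧ ConnOn G C ∧ ∃ v ∈ S, v ∉ C) Finset.card
    ⟨C₀, by
      simp only [Finset.mem_filter, Finset.mem_powerset]
      exact ⟨hC₀.trans (Finset.erase_subset _ _), hconn₀.1, hconn₀.2, v₀, hv₀,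
        fun h' => by simpa using hC₀ h'⟩⟩
  simp only [Finset.mem_filter, Finset.mem_powerset] at hC hmax
  obtain ⟨hCS, hCne, hCconn, v, hv, hvC⟩ := hC
  have hcross : ∃ x ∈ C, ∃ y ∈ S, G.Adj x y ∧ y ∉ C := by
    by_contra! hno
    exact hvC (h C hCS hCne (fun x hx y hy hxy => hno x hx y hy hxy) hv)
  obtain ⟨x, hx, y, hy, hxy, hyC⟩ := hcross
  refine ⟨y, hy, ?_⟩
  suffices C = S.erase y by rwa [← this]
  refine Finset.Subset.antisymm (fun z hz => by
    simp only [Finset.mem_erase]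
    exact ⟨fun h' => hyC (h' ▸ hz), hCS hz⟩) ?_
  intro z hz
  by_contra hzC
  simp only [Finset.mem_erase] at hz
  have := hmax (insert y C) ⟨by
    intro a ha
    rcases Finset.mem_insert.1 ha with rfl | ha
    exacts [hy, hCS ha], by simp, hCconn.insert_of_adj hx hxy, z, hz.2, by simp [hz.1, hzC]⟩
  rw [Finset.card_insert_of_notMem hyC] at this
  omega

omit [DecidableEq V] [DecidableRel G.Adj] in
lemma connOn_univ [Fintype V] (h : G.Connected) : ConnOn G Finset.univ := by
  intro U _ hne hcl z _
  obtain ⟨u, hu⟩ := hne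
  obtain ⟨w⟩ := h.preconnected u z
  induction w with
  | nil => exact hu
  | cons hadj _ ih => exact ih (Finset.mem_univ _) (hcl _ hu _ (Finset.mem_univ _) hadj)

variable [Fintype V] {p q : ℕ}

variable (G p q) in
/-- `G` has maximum degree at most `p + q + 2` and cannot be split into a `p`-degenerate and a
`q`-degenerate part. -/
structure Unsplittable : Prop where
  degree_le : ∀ v, degIn G v Finset.univ ≤ p + q + 2
  not_split : ∀ W : Finset V, DegenerateOn G Wᶜ p → DegenerateOn G W q → False

variable (G p q) in
/-- The sets `Wᶜ` and `W \ {v}` are a `p`-degenerate and a `q`-degenerate part covering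
everything but `v`. -/
structure IsHole (v : V) (W : Finset V) : Prop where
  mem : v ∈ W
  degenerate_compl : DegenerateOn G Wᶜ p
  degenerate_erase : DegenerateOn G (W.erase v) q

namespace IsHole

variable {v y : V} {W : Finset V}

lemma degIn_eq (h : IsHole G p q v W) (hG : Unsplittable G p q) :
    degIn G v W = q + 1 ∧ degIn G v Wᶜ = p + 1 := by
  have h1 : ¬ degIn G v Wᶜ ≤ p := fun hle => by
    refine hG.not_split (W.erase v) ?_ h.degenerate_erase
    rw [Finset.compl_erase]
    exact h.degenerate_compl.insert_of_degIn_le hle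
  have h2 : ¬ degIn G v W ≤ q := fun hle => by
    refine hG.not_split W h.degenerate_compl ?_
    rw [← Finset.insert_erase h.mem]
    exact h.degenerate_erase.insert_of_degIn_le (by rwa [degIn_erase_self])
  have h3 := hG.degree_le v
  rw [← degIn_add_degIn_compl v W] at h3
  omega

lemma move_mem (h : IsHole G p q v W) (hG : Unsplittable G p q) (hy : y ∈ W)
    (hvy : G.Adj v y) : IsHole G p q y W := by
  refine ⟨hy, h.degenerate_compl, ?_⟩
  have h1 := degIn_erase (G := G) v hy
  rw [if_pos hvy, (h.degIn_eq hG).1] at h1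
  have h2 := degIn_mono (G := G) v
    (Finset.erase_subset_erase y (Finset.erase_subset v W))
  refine ((h.degenerate_erase.mono (Finset.erase_subset y _)).insert_of_degIn_le
    (v := v) (by omega)).mono fun z hz => ?_
  simp only [Finset.mem_insert, Finset.mem_erase] at hz ⊢
  tauto

lemma move_notMem (h : IsHole G p q v W) (hG : Unsplittable G p q) (hy : y ∉ W)
    (hvy : G.Adj v y) : IsHole G p q y (insert y (W.erase v)) := by
  refine ⟨by simp, ?_, h.degenerate_erase.mono (Finset.erase_insert_subset _ _)⟩
  have h1 := degIn_erase (G := G) v (Finset.mem_compl.2 hy)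
  rw [if_pos hvy, (h.degIn_eq hG).2] at h1
  refine ((h.degenerate_compl.mono (Finset.erase_subset y _)).insert_of_degIn_le
    (v := v) (by omega)).mono fun z hz => ?_
  simp only [Finset.mem_insert, Finset.mem_erase, Finset.mem_compl] at hz ⊢
  tauto

lemma of_connOn (h : IsHole G p q v W) (hG : Unsplittable G p q) {C : Finset V}
    (hC : ConnOn G C) (hCW : C ⊆ W) (hv : v ∈ C) : ∀ x ∈ C, IsHole G p q x W :=
  hC.forall_mem (IsHole G p q · W) hv h fun _ _ hx _ hy hxy => hx.move_mem hG (hCW hy) hxy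

end IsHole

variable (G p q) in
/-- A hole outside `K` such that `K` is closed under adjacency in the `q`-degenerate part. -/
structure IsHoleOff (K : Finset V) (v : V) (W : Finset V) : Prop extends
    IsHole G p q v W where
  notMem : v ∉ K
  subset : K ⊆ W
  closed : ∀ x ∈ K, ∀ y ∈ W, y ≠ v → G.Adj x y → y ∈ K

variable (G q) in
/-- `K` is connected, and its vertices have `q + 1` neighbors in it, except that the `q + 1`
vertices in `N` have one fewer. -/
structure IsNearRegular (K N : Finset V) : Prop where
  conn : ConnOn G K
  subset : N ⊆ K
  card : N.card = q + 1
  degIn_eq : ∀ x ∈ K, degIn G x K + (if x ∈ N then 1 else 0) = q + 1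

variable (G p q) in
/-- `K` is near-regular, and `D` is a component of the complement of `K`, touching `K`, such that
the hole can be placed anywhere in `D` keeping `K` closed. -/
structure IsTrap (K N D : Finset V) : Prop extends IsNearRegular G q K N where
  conn_compl : ConnOn G D
  notMem_of_mem : ∀ d ∈ D, d ∉ K
  closed : ∀ d ∈ D, ∀ y ∉ K, G.Adj d y → y ∈ D
  touch : ∃ v ∈ D, ∃ x ∈ K, G.Adj v x
  hole : ∀ u ∈ D, ∃ W, IsHoleOff G p q K u W

namespace IsHoleOff

variable {v y : V} {W K N : Finset V}

lemma isHole_of_mem (h : IsHoleOff G p q K v W) (hG : Unsplittable G p q) (hK : ConnOn G K)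
    {x : V} (hx : x ∈ K) (hvx : G.Adj v x) : ∀ z ∈ K, IsHole G p q z W :=
  (h.move_mem hG (h.subset hx) hvx).of_connOn hG hK h.subset hx

lemma degIn_erase_eq (h : IsHoleOff G p q K v W) {x : V} (hx : x ∈ K) :
    degIn G x (W.erase v) = degIn G x K := by
  unfold degIn
  congr 1
  ext z
  simp only [Finset.mem_filter, Finset.mem_erase]
  constructor
  · rintro ⟨⟨h1, h2⟩, h3⟩
    exact ⟨h.closed x hx z h2 h1 h3, h3⟩
  · rintro ⟨h1, h3⟩
    exact ⟨⟨fun e => h.notMem (e ▸ h1), h.subset h1⟩, h3⟩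

lemma adj_iff (h : IsHoleOff G p q K v W) (hG : Unsplittable G p q)
    (hK : IsNearRegular G q K N) {x : V} (hx : x ∈ K) (hvx : G.Adj v x) :
    ∀ z ∈ W, G.Adj v z ↔ z ∈ N := by
  have key : ∀ z ∈ K, G.Adj v z ↔ z ∈ N := by
    intro z hz
    have h1 := ((h.isHole_of_mem hG hK.conn hx hvx z hz).degIn_eq hG).1
    rw [degIn_erase z h.mem, h.degIn_erase_eq hz] at h1
    have h2 := hK.degIn_eq z hz
    rw [G.adj_comm]
    by_cases h3 : G.Adj z v <;> by_cases h4 : z ∈ N <;> simp_all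
  have hsub : N ⊆ W.filter (G.Adj v ·) := fun z hz => by
    simp only [Finset.mem_filter]
    exact ⟨h.subset (hK.subset hz), (key z (hK.subset hz)).2 hz⟩
  have heq := Finset.eq_of_subset_of_card_le hsub (by
    rw [hK.card]; exact (h.degIn_eq hG).1.le)
  intro z hz
  rw [heq]
  simp [hz]

lemma exists_move (h : IsHoleOff G p q K v W) (hG : Unsplittable G p q)
    (hK : IsNearRegular G q K N) (hy : y ∉ K) (hvy : G.Adj v y) :
    ∃ W', IsHoleOff G p q K y W' := by
  by_cases hyW : y ∈ W
  · refine ⟨W, h.toIsHole.move_mem hG hyW hvy, hy, h.subset, fun x hx z hz hzy hxz => ?_⟩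
    by_cases hzv : z = v
    · subst hzv
      exact absurd (hK.subset ((h.adj_iff hG hK hx hxz.symm y hyW).1 hvy)) hy
    · exact h.closed x hx z hz hzv hxz
  · refine ⟨_, h.toIsHole.move_notMem hG hyW hvy, hy, fun x hx => ?_, fun x hx z hz hzy hxz => ?_⟩
    · simp only [Finset.mem_insert, Finset.mem_erase]
      exact Or.inr ⟨fun e => h.notMem (e ▸ hx), h.subset hx⟩
    · simp only [Finset.mem_insert, Finset.mem_erase, hzy, false_or] at hz
      exact h.closed x hx z hz.2 hz.1 hxz

end IsHoleOff

/-- Every hole gives a trap inside its component. -/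
lemma IsHole.exists_isTrap {v : V} {W Z : Finset V} (h : IsHole G p q v W)
    (hG : Unsplittable G p q) (hZ : ConnOn G Z) (hZW : Z ⊆ W) (hv : v ∈ Z)
    (hcl : ∀ x ∈ Z, ∀ y ∈ W, G.Adj x y → y ∈ Z) :
    ∃ K N D, K ⊆ Z ∧ IsTrap G p q K N D := by
  obtain ⟨u, hu, hconn⟩ := hZ.exists_erase ⟨v, hv⟩
  have hole := h.of_connOn hG hZ hZW hv
  have hdeg : ∀ x ∈ Z, degIn G x Z = q + 1 := by
    intro x hx
    rw [← ((hole x hx).degIn_eq hG).1]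
    unfold degIn
    congr 1
    ext z
    simp only [Finset.mem_filter]
    exact ⟨fun hz => ⟨hZW hz.1, hz.2⟩, fun hz => ⟨hcl x hx z hz.1 hz.2, hz.2⟩⟩
  have huK : u ∉ Z.erase u := Finset.notMem_erase u Z
  have hnear : IsNearRegular G q (Z.erase u) (Z.filter (G.Adj u ·)) := by
    refine ⟨hconn, fun z hz => ?_, hdeg u hu, fun x hx => ?_⟩
    · simp only [Finset.mem_filter, Finset.mem_erase] at hz ⊢
      exact ⟨hz.2.ne', hz.1⟩
    · rw [← hdeg x (Finset.mem_of_mem_erase hx), degIn_erase x hu]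
      simp [Finset.mem_of_mem_erase hx, G.adj_comm]
  have hoff : IsHoleOff G p q (Z.erase u) u W := by
    refine ⟨hole u hu, huK, (Finset.erase_subset _ _).trans hZW, fun x hx y hy hne hxy => ?_⟩
    exact Finset.mem_erase.2 ⟨hne, hcl x (Finset.mem_of_mem_erase hx) y hy hxy⟩
  obtain ⟨D, hDK, huD, hD, hDcl⟩ :=
    exists_component (G := G) (S := (Z.erase u)ᶜ) (Finset.mem_compl.2 huK)
  refine ⟨_, _, D, Finset.erase_subset u Z, hnear, hD, fun d hd => Finset.mem_compl.1 (hDK hd),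
    fun d hd y hy hdy => hDcl d hd y (Finset.mem_compl.2 hy) hdy, ⟨u, huD, ?_⟩, ?_⟩
  · obtain ⟨x, hx⟩ : (Z.filter (G.Adj u ·)).Nonempty := by
      rw [← Finset.card_pos, hnear.card]; omega
    exact ⟨x, hnear.subset hx, (Finset.mem_filter.1 hx).2⟩
  · refine hD.forall_mem (fun u' => ∃ W, IsHoleOff G p q (Z.erase u) u' W) huD ⟨W, hoff⟩ ?_
    rintro x - ⟨W', hW'⟩ y hy hxy
    exact hW'.exists_move hG hnear (Finset.mem_compl.1 (hDK hy)) hxy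

namespace IsTrap

variable {K N D : Finset V}

lemma adj_iff (h : IsTrap G p q K N D) (hG : Unsplittable G p q) {t x : V} (ht : t ∈ D)
    (hx : x ∈ K) (htx : G.Adj t x) {z : V} (hz : z ∈ K) : G.Adj t z ↔ z ∈ N := by
  obtain ⟨W, hW⟩ := h.hole t ht
  exact hW.adj_iff hG h.toIsNearRegular hx htx z (hW.subset hz)

lemma exists_hole_adj (h : IsTrap G p q K N D) (hG : Unsplittable G p q) :
    ∃ v ∈ D, ∃ W, IsHoleOff G p q K v W ∧ (∀ z ∈ W, G.Adj v z ↔ z ∈ N) ∧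
      ∀ x ∈ K, IsHole G p q x W := by
  obtain ⟨v, hv, x, hx, hvx⟩ := h.touch
  obtain ⟨W, hW⟩ := h.hole v hv
  exact ⟨v, hv, W, hW, hW.adj_iff hG h.toIsNearRegular hx hvx,
    hW.isHole_of_mem hG h.conn hx hvx⟩

lemma nonempty (h : IsTrap G p q K N D) : N.Nonempty := by
  rw [← Finset.card_pos, h.card]; omega

lemma degIn_of_mem (h : IsTrap G p q K N D) {x : V} (hx : x ∈ N) : degIn G x K = q := by
  have := h.degIn_eq x (h.subset hx)
  rw [if_pos hx] at this
  omega

lemma degIn_compl_of_mem (h : IsTrap G p q K N D) (hG : Unsplittable G p q) {x : V}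
    (hx : x ∈ N) : degIn G x Kᶜ = p + 2 := by
  obtain ⟨v, -, W, -, -, hW⟩ := h.exists_hole_adj hG
  have h1 := (hW x (h.subset hx)).degIn_eq hG
  have h2 := degIn_add_degIn_compl (G := G) x W
  have h3 := degIn_add_degIn_compl (G := G) x K
  have h4 := h.degIn_of_mem hx
  omega

lemma degIn_compl_of_touch (h : IsTrap G p q K N D) (hG : Unsplittable G p q) {v x : V}
    (hv : v ∈ D) (hx : x ∈ K) (hvx : G.Adj v x) : degIn G v Kᶜ = p + 1 := by
  obtain ⟨W, hW⟩ := h.hole v hv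
  have h1 := hW.toIsHole.degIn_eq hG
  have h2 := degIn_add_degIn_compl (G := G) v W
  have h3 := degIn_add_degIn_compl (G := G) v K
  have h4 : degIn G v K = q + 1 := by
    rw [← h.card]
    unfold degIn
    congr 1
    ext z
    simp only [Finset.mem_filter]
    exact ⟨fun hz => (h.adj_iff hG hv hx hvx hz.1).1 hz.2,
      fun hz => ⟨h.subset hz, (h.adj_iff hG hv hx hvx (h.subset hz)).2 hz⟩⟩
  omega

/-- Two vertices of `D` joined to `N` are adjacent, and `N` is a clique. -/
lemma adj_of_adj (h : IsTrap G p q K N D) (hG : Unsplittable G p q) (hq : 1 ≤ q) {v t x : V}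
    (hv : v ∈ D) (ht : t ∈ D) (hx : x ∈ N) (hvx : G.Adj v x) (htx : G.Adj t x) (hvt : v ≠ t) :
    G.Adj v t ∧ ∀ l ∈ N, l ≠ x → G.Adj l x := by
  obtain ⟨W, hW⟩ := h.hole v hv
  have hxK := h.subset hx
  have holes := hW.isHole_of_mem hG h.conn hxK hvx
  have htK := h.notMem_of_mem t ht
  have htW : t ∉ W := fun htW => htK (hW.closed x hxK t htW hvt.symm htx.symm)
  have hole_t := (holes x hxK).move_notMem hG htW htx.symm
  set W' := insert t (W.erase x) with hW'
  have htW' : t ∉ W.erase x := fun h' => htW (Finset.mem_of_mem_erase h')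
  have hdeg : ∀ z, degIn G z W + (if G.Adj z t then 1 else 0) =
      degIn G z W' + (if G.Adj z x then 1 else 0) := by
    intro z
    rw [degIn_insert z htW', degIn_erase z (holes x hxK).mem]
    omega
  have hole_l : ∀ l ∈ N, l ≠ x → IsHole G p q l W' := by
    intro l hl hlx
    refine hole_t.move_mem hG ?_ ((h.adj_iff hG ht hxK htx (h.subset hl)).2 hl)
    simp [hW', hlx, hW.subset (h.subset hl)]
  constructor
  · obtain ⟨l, hl, hlx⟩ : ∃ l ∈ N, l ≠ x := by
      apply Finset.exists_mem_ne
      rw [h.card]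
      omega
    have hole_v : IsHole G p q v W' := by
      refine (hole_l l hl hlx).move_mem hG ?_
        ((h.adj_iff hG hv hxK hvx (h.subset hl)).2 hl).symm
      simp [hW', hvx.ne, hW.mem]
    have := hdeg v
    rw [(hole_v.degIn_eq hG).1, (hW.toIsHole.degIn_eq hG).1, if_pos hvx] at this
    by_contra hno
    rw [if_neg hno] at this
    omega
  · intro l hl hlx
    have := hdeg l
    rw [((hole_l l hl hlx).degIn_eq hG).1, ((holes l (h.subset hl)).degIn_eq hG).1,
      if_pos ((h.adj_iff hG ht hxK htx (h.subset hl)).2 hl).symm] at this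
    by_contra hno
    rw [if_neg hno] at this
    omega

/-- If `N` has no neighbors outside `K ∪ D`, then `G` is complete. -/
lemma eq_top (h : IsTrap G p q K N D) (hG : Unsplittable G p q) (hq : 1 ≤ q)
    (hconn : G.Connected) (hN : ∀ x ∈ N, ∀ y, G.Adj x y → y ∈ K ∨ y ∈ D) : G = ⊤ := by
  obtain ⟨x₀, hx₀⟩ := h.nonempty
  set T := Kᶜ.filter (G.Adj x₀ ·) with hT
  have hTcard : T.card = p + 2 := h.degIn_compl_of_mem hG hx₀
  have hTD : ∀ t ∈ T, t ∈ D := by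
    intro t ht
    simp only [hT, Finset.mem_filter, Finset.mem_compl] at ht
    exact (hN x₀ hx₀ t ht.2).resolve_left ht.1
  have hTN : ∀ t ∈ T, ∀ x ∈ N, G.Adj t x := by
    intro t ht x hx
    exact (h.adj_iff hG (hTD t ht) (h.subset hx₀) (Finset.mem_filter.1 ht).2.symm
      (h.subset hx)).2 hx
  have hTT : ∀ v ∈ T, ∀ t ∈ T, v ≠ t → G.Adj v t := fun v hv t ht hvt =>
    (h.adj_of_adj hG hq (hTD v hv) (hTD t ht) hx₀ (hTN v hv x₀ hx₀) (hTN t ht x₀ hx₀) hvt).1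
  have hNN : ∀ x ∈ N, ∀ l ∈ N, l ≠ x → G.Adj l x := by
    intro x hx
    obtain ⟨v, hv, t, ht, hvt⟩ := Finset.one_lt_card.1 (by omega : 1 < T.card)
    exact (h.adj_of_adj hG hq (hTD v hv) (hTD t ht) hx (hTN v hv x hx) (hTN t ht x hx) hvt).2
  have hKN : K ⊆ N := by
    refine h.conn N h.subset h.nonempty fun x hx y hy hxy => ?_
    have hsub : N.erase x ⊆ K.filter (G.Adj x ·) := fun z hz => by
      rw [Finset.mem_erase] at hz
      exact Finset.mem_filter.2 ⟨h.subset hz.2, (hNN x hx z hz.2 hz.1).symm⟩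
    have heq := Finset.eq_of_subset_of_card_le hsub (by
      rw [Finset.card_erase_of_mem hx, h.card]
      exact (h.degIn_of_mem hx).le)
    exact Finset.mem_of_mem_erase (heq ▸ Finset.mem_filter.2 ⟨hy, hxy⟩)
  have hcover : Finset.univ ⊆ N ∪ T := by
    refine connOn_univ hconn _ (Finset.subset_univ _) ⟨x₀, by simp [hx₀]⟩ ?_
    intro x hx y _ hxy
    rcases Finset.mem_union.1 hx with hx | hx
    · by_cases hyK : y ∈ K
      · exact Finset.mem_union_left _ (hKN hyK)
      · have hyD := (hN x hx y hxy).resolve_left hyK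
        refine Finset.mem_union_right _ (Finset.mem_filter.2 ⟨Finset.mem_compl.2 hyK, ?_⟩)
        exact ((h.adj_iff hG hyD (h.subset hx) hxy.symm (h.subset hx₀)).2 hx₀).symm
    · have hsub : N ∪ T.erase x ⊆ Finset.univ.filter (G.Adj x ·) := by
        intro z hz
        simp only [Finset.mem_union, Finset.mem_erase] at hz
        simp only [Finset.mem_filter_univ]
        rcases hz with hz | hz
        exacts [hTN x hx z hz, hTT x hx z hz.2 hz.1.symm]
      have hdisj : Disjoint N (T.erase x) := by
        rw [Finset.disjoint_left]
        intro z hz hzT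
        exact h.notMem_of_mem z (hTD z (Finset.mem_of_mem_erase hzT)) (h.subset hz)
      have heq := Finset.eq_of_subset_of_card_le hsub (by
        rw [Finset.card_union_of_disjoint hdisj, h.card, Finset.card_erase_of_mem hx, hTcard]
        have := hG.degree_le x
        unfold degIn at this
        omega)
      have hy : y ∈ N ∪ T.erase x := heq ▸ (by simpa using hxy)
      simp only [Finset.mem_union, Finset.mem_erase] at hy ⊢
      tauto
  ext a b
  rw [SimpleGraph.top_adj]
  refine ⟨fun hab => hab.ne, fun hab => ?_⟩
  rcases Finset.mem_union.1 (hcover (Finset.mem_univ a)) with ha | ha <;>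
    rcases Finset.mem_union.1 (hcover (Finset.mem_univ b)) with hb | hb
  · exact hNN b hb a ha hab
  · exact (hTN b hb a ha).symm
  · exact hTN a ha b hb
  · exact hTT a ha b hb hab

/-- If `N` has a neighbor outside `K ∪ D`, then some trap misses a connected set larger
than `D`. -/
lemma exists_larger_component (h : IsTrap G p q K N D) (hG : Unsplittable G p q) {x u : V}
    (hx : x ∈ N) (huK : u ∉ K) (huD : u ∉ D) (hxu : G.Adj x u) :
    ∃ K' N' D', IsTrap G p q K' N' D' ∧ ConnOn G (insert x D) ∧ Disjoint (insert x D) K' := by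
  obtain ⟨v, hv, W, hW, hadj, holes⟩ := h.exists_hole_adj hG
  have hxK := h.subset hx
  have hvx : G.Adj v x := (hadj x (hW.subset hxK)).2 hx
  have huv : u ≠ v := fun e => huD (e ▸ hv)
  have huW : u ∉ W := fun hu => huK (hW.closed x hxK u hu huv hxu)
  have hvu : ¬ G.Adj v u := fun hvu => huD (h.closed v hv u huK hvu)
  have hole_u := (holes x hxK).move_notMem hG huW hxu
  set W' := insert u (W.erase x) with hW'
  obtain ⟨Z, hZW, huZ, hZ, hcl⟩ := exists_component (G := G) hole_u.mem
  have hvZ : v ∉ Z := by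
    intro hvZ
    have h1 := ((hole_u.of_connOn hG hZ hZW huZ v hvZ).degIn_eq hG).1
    have h2 := (hW.toIsHole.degIn_eq hG).1
    rw [degIn_insert v (fun h' => huW (Finset.mem_of_mem_erase h')), if_neg hvu] at h1
    rw [degIn_erase v (hW.subset hxK), if_pos hvx] at h2
    omega
  have hZD : ∀ z ∈ Z, z ∉ D := by
    refine hZ.forall_mem (· ∉ D) huZ huD fun z hz hzD y hy hzy hyD => ?_
    have hzK : z ∈ K := by
      by_contra hzK
      exact hzD (h.closed y hyD z hzK hzy.symm)
    have hzN := (h.adj_iff hG hyD hzK hzy.symm hzK).1 hzy.symm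
    refine hvZ (hcl z hz v ?_ ((hadj z (hW.subset hzK)).2 hzN).symm)
    simp [hW', hvx.ne, hW.mem]
  obtain ⟨K', N', D', hK'Z, hK'⟩ := hole_u.exists_isTrap hG hZ hZW huZ hcl
  refine ⟨K', N', D', hK', h.conn_compl.insert_of_adj hv hvx, ?_⟩
  rw [Finset.disjoint_left]
  intro z hz hzK'
  have hzZ := hK'Z hzK'
  rcases Finset.mem_insert.1 hz with rfl | hzD
  · have := hZW hzZ
    simp only [hW', Finset.mem_insert, Finset.mem_erase] at this
    exact this.elim hxu.ne (fun h' => h'.1 rfl)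
  · exact hZD z hzZ hzD

/-- If some vertex of `D` has no neighbor in `K`, then some trap lies inside `D`. -/
lemma exists_subset (h : IsTrap G p q K N D) (hG : Unsplittable G p q) {w : V} (hw : w ∈ D)
    (hwK : ∀ x ∈ K, ¬ G.Adj w x) : ∃ K' N' D', IsTrap G p q K' N' D' ∧ K' ⊆ D := by
  obtain ⟨v, hv, w, hw, hvw, ⟨x, hx, hvx⟩, hwK⟩ : ∃ v ∈ D, ∃ w ∈ D, G.Adj v w ∧
      (∃ x ∈ K, G.Adj v x) ∧ ∀ x ∈ K, ¬ G.Adj w x := by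
    by_contra! hno
    obtain ⟨v, hv, x, hx, hvx⟩ := h.touch
    obtain ⟨y, hy, hwy⟩ := h.conn_compl.forall_mem (fun d => ∃ x ∈ K, G.Adj d x) hv ⟨x, hx, hvx⟩
      (fun a ha ⟨y, hy, hay⟩ b hb hab => hno a ha b hb hab ⟨y, hy, hay⟩) w hw
    exact hwK y hy hwy
  obtain ⟨W, hW⟩ := h.hole v hv
  have hwW : w ∉ W := fun hwW => h.notMem_of_mem w hw
    (h.subset ((hW.adj_iff hG h.toIsNearRegular hx hvx w hwW).1 hvw))
  have hole_w := hW.toIsHole.move_notMem hG hwW hvw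
  obtain ⟨Z, hZW, hwZ, hZ, hcl⟩ := exists_component (G := G) hole_w.mem
  have hZK : ∀ z ∈ Z, z ∈ D := by
    refine hZ.forall_mem (· ∈ D) hwZ hw fun z hz hzD y hy hzy => ?_
    refine h.closed z hzD y (fun hyK => ?_) hzy
    have := hZW hz
    simp only [Finset.mem_insert, Finset.mem_erase] at this
    rcases this with rfl | ⟨hzv, hzW⟩
    · exact hwK y hyK hzy
    · exact h.notMem_of_mem z hzD (hW.closed y hyK z hzW hzv hzy.symm)
  obtain ⟨K', N', D', hK'Z, hK'⟩ := hole_w.exists_isTrap hG hZ hZW hwZ hcl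
  exact ⟨K', N', D', hK', fun z hz => hZK z (hK'Z hz)⟩

/-- A connected set missing a trap can be enlarged, unless `G` is complete. -/
lemma exists_lt_card (h : IsTrap G p q K N D) (hG : Unsplittable G p q) (hq : 1 ≤ q)
    (hconn : G.Connected) (hnc : G ≠ ⊤) {E : Finset V} (hE : ConnOn G E) (hne : E.Nonempty)
    (hEK : Disjoint E K) : ∃ K' N' D' E', IsTrap G p q K' N' D' ∧ ConnOn G E' ∧ E'.Nonempty ∧
      Disjoint E' K' ∧ E.card < E'.card := by
  obtain ⟨x, hx, u, hxu, huK, huD⟩ : ∃ x ∈ N, ∃ u, G.Adj x u ∧ u ∉ K ∧ u ∉ D := by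
    by_contra! hno
    exact hnc (h.eq_top hG hq hconn fun x hx y hxy => by
      by_cases hy : y ∈ K
      exacts [Or.inl hy, Or.inr (hno x hx y hxy hy)])
  rw [Finset.disjoint_left] at hEK
  by_cases hED : ∃ e ∈ E, e ∈ D
  · obtain ⟨e, he, heD⟩ := hED
    have hsub : E ⊆ D := hE.forall_mem (· ∈ D) he heD
      fun a _ haD b hb hab => h.closed a haD b (hEK hb) hab
    obtain ⟨K', N', D', h', hc, hd⟩ := h.exists_larger_component hG hx huK huD hxu
    refine ⟨K', N', D', _, h', hc, by simp, hd, (Finset.card_le_card hsub).trans_lt ?_⟩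
    rw [Finset.card_insert_of_notMem fun hxD => h.notMem_of_mem x hxD (h.subset hx)]
    omega
  · push Not at hED
    obtain ⟨w, hw, hwK⟩ : ∃ w ∈ D, ∀ x ∈ K, ¬ G.Adj w x := by
      by_contra! hall
      obtain ⟨v, hv, y, hy, hvy⟩ := h.touch
      have h1 := h.degIn_compl_of_touch hG hv hy hvy
      have h2 := h.degIn_compl_of_mem hG hx
      have h3 : D ⊆ (Kᶜ.filter (G.Adj x ·)).erase u := by
        intro d hd
        obtain ⟨z, hz, hdz⟩ := hall d hd
        simp only [Finset.mem_erase, Finset.mem_filter, Finset.mem_compl]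
        exact ⟨fun e => huD (e ▸ hd), h.notMem_of_mem d hd,
          ((h.adj_iff hG hd hz hdz (h.subset hx)).2 hx).symm⟩
      have h4 : Kᶜ.filter (G.Adj v ·) ⊆ D.erase v := by
        intro d hd
        simp only [Finset.mem_erase, Finset.mem_filter, Finset.mem_compl] at hd ⊢
        exact ⟨hd.2.ne', h.closed v hv d hd.1 hd.2⟩
      have h5 := Finset.card_le_card h3
      have h6 := Finset.card_le_card h4
      rw [Finset.card_erase_of_mem (by simpa using ⟨huK, hxu⟩)] at h5
      rw [Finset.card_erase_of_mem hv] at h6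
      have h7 : 0 < D.card := Finset.card_pos.2 ⟨v, hv⟩
      unfold degIn at h1 h2
      omega
    obtain ⟨K', N', D', h', hK'D⟩ := h.exists_subset hG hw hwK
    obtain ⟨e, he, y, hy, hey⟩ : ∃ e ∈ E, ∃ y ∉ E, G.Adj e y := by
      by_contra! hno
      refine hED w ?_ hw
      exact connOn_univ hconn E (Finset.subset_univ _) hne
        (fun a ha b _ hab => by_contra fun hb => hno a ha b hb hab) (Finset.mem_univ w)
    refine ⟨K', N', D', insert y E, h', hE.insert_of_adj he hey, by simp, ?_, ?_⟩
    · rw [Finset.disjoint_left]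
      intro z hz hzK'
      rcases Finset.mem_insert.1 hz with rfl | hzE
      · exact hED e he (h.closed z (hK'D hzK') e (hEK he) hey.symm)
      · exact hED z hzE (hK'D hzK')
    · rw [Finset.card_insert_of_notMem hy]
      omega

end IsTrap

lemma exists_isHole (hG : Unsplittable G p q) (hconn : G.Connected) :
    ∃ v W, IsHole G p q v W := by
  suffices key : ∀ Y W : Finset V, Y.Nonempty → ConnOn G Y → Y ⊆ W → DegenerateOn G Wᶜ p →
      DegenerateOn G (W \ Y) q → ∃ v W, IsHole G p q v W by
    obtain ⟨v⟩ := hconn.nonempty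
    refine key Finset.univ Finset.univ ⟨v, Finset.mem_univ v⟩ (connOn_univ hconn) le_rfl ?_ ?_ <;>
    · intro B hB hne
      simp [hne.ne_empty] at hB
  intro Y
  induction Y using Finset.strongInduction with
  | H Y ih =>
    intro W hne hY hYW hW hWY
    obtain ⟨y, hy, hYy⟩ := hY.exists_erase hne
    have hss := Finset.erase_ssubset hy
    rcases (Y.erase y).eq_empty_or_nonempty with h0 | hne'
    · refine ⟨y, W, hYW hy, hW, hWY.mono fun z hz => ?_⟩
      simp only [Finset.mem_erase, Finset.mem_sdiff] at hz ⊢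
      refine ⟨hz.2, fun hzY => ?_⟩
      have : z ∈ Y.erase y := Finset.mem_erase.2 ⟨hz.1, hzY⟩
      simp [h0] at this
    obtain ⟨z, hz⟩ := hne'
    obtain ⟨hzy, hzY⟩ := Finset.mem_erase.1 hz
    obtain ⟨x, hx, hyx⟩ := hY.exists_adj hy hzY hzy.symm
    have h1 : 0 < degIn G y Y := Finset.card_pos.2 ⟨x, by simp [hx, hyx]⟩
    have h2 : degIn G y (W \ Y) + degIn G y Y = degIn G y W := by
      unfold degIn
      rw [← Finset.card_union_of_disjoint
        (Finset.disjoint_filter_filter Finset.sdiff_disjoint), ← Finset.filter_union,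
        Finset.sdiff_union_of_subset hYW]
    have h3 := degIn_add_degIn_compl (G := G) y W
    have h4 := hG.degree_le y
    by_cases h5 : degIn G y Wᶜ ≤ p
    · refine ih _ hss (W.erase y) ⟨z, hz⟩ hYy (Finset.erase_subset_erase y hYW) ?_ ?_
      · rw [Finset.compl_erase]
        exact hW.insert_of_degIn_le h5
      · refine hWY.mono fun a ha => ?_
        simp only [Finset.mem_erase, Finset.mem_sdiff] at ha ⊢
        tauto
    · refine ih _ hss W ⟨z, hz⟩ hYy ((Finset.erase_subset y Y).trans hYW) hW ?_
      rw [Finset.sdiff_erase (hYW hy)]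
      exact hWY.insert_of_degIn_le (by omega)

lemma not_unsplittable (hq : 1 ≤ q) (hconn : G.Connected) (hnc : G ≠ ⊤) :
    ¬ Unsplittable G p q := by
  intro hG
  classical
  obtain ⟨v, W, h⟩ := exists_isHole hG hconn
  obtain ⟨Z, hZW, hvZ, hZ, hcl⟩ := exists_component (G := G) h.mem
  obtain ⟨K, N, D, -, hK⟩ := h.exists_isTrap hG hZ hZW hvZ hcl
  obtain ⟨d, hd, -⟩ := hK.touch
  obtain ⟨E, hE, hmax⟩ := Finset.exists_max_image
    (Finset.univ.filter fun E => ConnOn G E ∧ E.Nonempty ∧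
      ∃ K N D, IsTrap G p q K N D ∧ Disjoint E K) Finset.card
    ⟨D, by
      simp only [Finset.mem_filter_univ]
      exact ⟨hK.conn_compl, ⟨d, hd⟩, K, N, D, hK, Finset.disjoint_left.2 hK.notMem_of_mem⟩⟩
  simp only [Finset.mem_filter_univ] at hE hmax
  obtain ⟨hE, hne, K, N, D, hK, hEK⟩ := hE
  obtain ⟨K', N', D', E', hK', hE', hne', hEK', hlt⟩ :=
    hK.exists_lt_card hG hq hconn hnc hE hne hEK
  exact absurd (hmax E' ⟨hE', hne', K', N', D', hK', hEK'⟩) (by omega)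

/-- The case of two parts, without the bound on the maximum degrees. -/
lemma exists_split (hpq : 1 ≤ p + q) (hconn : G.Connected) (hnc : G ≠ ⊤)
    (hdeg : ∀ v, degIn G v Finset.univ ≤ p + q + 2) :
    ∃ W : Finset V, DegenerateOn G Wᶜ p ∧ DegenerateOn G W q := by
  by_contra! hno
  rcases Nat.eq_zero_or_pos q with rfl | hq
  · refine not_unsplittable (p := 0) (q := p) (by omega) hconn hnc
      ⟨fun v => by have := hdeg v; omega, fun W h1 h2 => hno Wᶜ (by rwa [compl_compl]) h1⟩
  · exact not_unsplittable hq hconn hnc ⟨hdeg, hno⟩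

variable {ι : Type*} [DecidableEq ι]

omit [DecidableEq V] [Fintype V] in
lemma sum_degIn_le (v : V) (S : Finset V) (c : V → ι) (I : Finset ι) :
    ∑ i ∈ I, degIn G v (S.filter (c · = i)) ≤ degIn G v S := by
  classical
  unfold degIn
  rw [← Finset.card_biUnion]
  · refine Finset.card_le_card fun z hz => ?_
    simp only [Finset.mem_biUnion, Finset.mem_filter] at hz ⊢
    obtain ⟨i, -, hz⟩ := hz
    exact ⟨hz.1.1, hz.2⟩
  · intro i _ j _ hij
    refine Finset.disjoint_left.2 fun z hz hz' => ?_
    simp only [Finset.mem_filter] at hz hz'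
    exact hij (hz.1.2.symm.trans hz'.1.2)

omit [Fintype V] in
/-- A degenerate set splits greedily into parts of smaller degeneracy. -/
lemma exists_coloring_of_degenerateOn {d : ℕ} (f : ι → ℕ) (I : Finset ι)
    (hI : d + 1 ≤ ∑ i ∈ I, (f i + 1)) (W : Finset V) (hW : DegenerateOn G W d) :
    ∃ c : V → ι, (∀ v, c v ∈ I) ∧ ∀ i ∈ I, DegenerateOn G (W.filter (c · = i)) (f i) := by
  induction W using Finset.strongInduction with
  | H W ih =>
    rcases W.eq_empty_or_nonempty with rfl | hne
    · obtain ⟨i, hi⟩ : I.Nonempty := by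
        rw [Finset.nonempty_iff_ne_empty]
        rintro rfl
        simp at hI
      refine ⟨fun _ => i, fun _ => hi, fun j _ B hB hne => ?_⟩
      simp [hne.ne_empty] at hB
    · obtain ⟨v, hv, hvd⟩ := hW W le_rfl hne
      obtain ⟨c, hcI, hc⟩ := ih _ (Finset.erase_ssubset hv) (hW.mono (Finset.erase_subset v W))
      obtain ⟨j, hj, hjd⟩ : ∃ j ∈ I, degIn G v ((W.erase v).filter (c · = j)) ≤ f j := by
        by_contra! hno
        have h1 : ∑ i ∈ I, (f i + 1) ≤ _ := Finset.sum_le_sum hno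
        have h2 := sum_degIn_le (G := G) v (W.erase v) c I
        rw [degIn_erase_self] at h2
        unfold degIn at h1 h2
        omega
      refine ⟨Function.update c v j, fun w => ?_, fun i hi => ?_⟩
      · by_cases hw : w = v
        · subst hw; simpa using hj
        · simpa [hw] using hcI w
      · by_cases hij : i = j
        · subst hij
          refine ((hc i hi).insert_of_degIn_le hjd).mono fun z hz => ?_
          by_cases hzv : z = v <;> simp_all
        · refine (hc i hi).mono fun z hz => ?_
          by_cases hzv : z = v <;> simp_all

/-- Recoloring vertices of large degree in their class bounds the maximum degree of each class
while keeping every class degenerate. -/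
lemma exists_coloring_degIn_le [Fintype ι] (f : ι → ℕ)
    (hdeg : ∀ v, degIn G v Finset.univ ≤ ∑ i, (f i + 1))
    (hc : ∃ c : V → ι, ∀ i, DegenerateOn G (Finset.univ.filter (c · = i)) (f i)) :
    ∃ c : V → ι, (∀ i, DegenerateOn G (Finset.univ.filter (c · = i)) (f i)) ∧
      ∀ v, degIn G v (Finset.univ.filter (c · = c v)) ≤ f (c v) + 1 := by
  classical
  let F : (V → ι) → V → ℤ := fun c u =>
    (degIn G u (Finset.univ.filter (c · = c u)) : ℤ) - 2 * f (c u)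
  obtain ⟨c₀, hc₀⟩ := hc
  obtain ⟨c, hc, hmin⟩ := Finset.exists_min_image
    (Finset.univ.filter fun c : V → ι =>
      ∀ i, DegenerateOn G (Finset.univ.filter (c · = i)) (f i)) (fun c => ∑ u, F c u)
    ⟨c₀, by simpa only [Finset.mem_filter_univ] using hc₀⟩
  simp only [Finset.mem_filter_univ] at hc hmin
  refine ⟨c, hc, fun v => ?_⟩
  by_contra! hv
  obtain ⟨j, hj⟩ : ∃ j, degIn G v (Finset.univ.filter (c · = j)) ≤ f j := by
    by_contra! hno
    have h1 : ∑ i, (f i + 1) < ∑ i, degIn G v (Finset.univ.filter (c · = i)) :=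
      Finset.sum_lt_sum (fun i _ => hno i) ⟨c v, Finset.mem_univ _, hv⟩
    have h2 := sum_degIn_le (G := G) v Finset.univ c Finset.univ
    have h3 := hdeg v
    omega
  have hjv : c v ≠ j := by
    rintro rfl
    omega
  set c' := Function.update c v j with hc'
  have hclass : ∀ i, i ≠ j →
      Finset.univ.filter (c' · = i) = (Finset.univ.filter (c · = i)).erase v := by
    intro i hi
    ext z
    by_cases hz : z = v
    · subst hz; simp [hc', hi.symm]
    · simp [hc', hz]
  have hclass_j : Finset.univ.filter (c' · = j) = insert v (Finset.univ.filter (c · = j)) := by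
    ext z
    by_cases hz : z = v
    · subst hz; simp [hc']
    · simp [hc', hz]
  have hvj : v ∉ Finset.univ.filter (c · = j) := by simp [hjv]
  have hdegen : ∀ i, DegenerateOn G (Finset.univ.filter (c' · = i)) (f i) := by
    intro i
    by_cases hi : i = j
    · subst hi
      rw [hclass_j]
      exact (hc i).insert_of_degIn_le hj
    · rw [hclass i hi]
      exact (hc i).mono (Finset.erase_subset _ _)
  let e : ι → V → ℤ := fun k u => if c u = k ∧ G.Adj v u then 1 else 0
  have he : ∀ k, ∑ u, e k u = degIn G v (Finset.univ.filter (c · = k)) := by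
    intro k
    simp only [e, degIn, Finset.filter_filter, Finset.sum_boole]
  have hF : ∀ u, F c' u = F c u + e j u - e (c v) u +
      if u = v then ((degIn G v (Finset.univ.filter (c · = j)) : ℤ) - 2 * f j) -
        (degIn G v (Finset.univ.filter (c · = c v)) - 2 * f (c v)) else 0 := by
    intro u
    by_cases huv : u = v
    · subst huv
      have hcu : c' u = j := by simp [hc']
      simp only [F, e, hcu, hclass_j, degIn_insert u hvj]
      simp
    · have hcu : c' u = c u := by simp [hc', huv]
      simp only [F, e, hcu, huv, if_false, add_zero]
      by_cases h1 : c u = j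
      · rw [h1, hclass_j, degIn_insert u hvj]
        simp only [G.adj_comm v u, hjv.symm]
        push_cast
        simp
        ring
      · rw [hclass _ h1]
        by_cases h2 : c u = c v
        · rw [degIn_erase (S := Finset.univ.filter (c · = c u)) (v := u) (u := v)
            (by simp [h2])]
          simp only [G.adj_comm v u, h2, hjv]
          push_cast
          simp
          ring
        · rw [Finset.erase_eq_of_notMem (by simp [Ne.symm h2])]
          simp [h1, h2]
  have hsum : ∑ u, F c' u = ∑ u, F c u + degIn G v (Finset.univ.filter (c · = j))
      - degIn G v (Finset.univ.filter (c · = c v)) +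
      (((degIn G v (Finset.univ.filter (c · = j)) : ℤ) - 2 * f j) -
        (degIn G v (Finset.univ.filter (c · = c v)) - 2 * f (c v))) := by
    rw [Finset.sum_congr rfl fun u _ => hF u, Finset.sum_add_distrib, Finset.sum_sub_distrib,
      Finset.sum_add_distrib, he, he, Finset.sum_ite_eq' Finset.univ v]
    simp
  have := hmin c' hdegen
  omega

end

end BorodinBollobasManvel

/-- **Borodin; Bollobás–Manvel.**  Let `G` be a non-complete connected graph with
maximum degree `Δ ≥ 3`.  Let `s ≥ 2` and `p 1, …, p s ≥ 0` be integers with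
`∑ p i ≥ Δ - s`.  Then `V(G)` can be partitioned into sets `A 1, …, A s` such that
each `G[A i]` is `p i`-degenerate and has maximum degree at most `p i + 1`. -/
theorem borodin_bollobas_manvel {V : Type*} [Fintype V] [DecidableEq V]
    (G : SimpleGraph V) [DecidableRel G.Adj]
    (hconn : G.Connected) (hΔ : 3 ≤ G.maxDegree) (hnc : G ≠ ⊤)
    (s : ℕ) (hs : 2 ≤ s) (p : Fin s → ℕ)
    (hp : (G.maxDegree : ℤ) - (s : ℤ) ≤ ∑ i, (p i : ℤ)) :
    ∃ A : Fin s → Finset V,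
      (∀ v : V, ∃! i, v ∈ A i) ∧
      (∀ i, DegenerateOn G (A i) (p i)) ∧
      (∀ i, ∀ v ∈ A i, ((A i).filter (fun u => G.Adj v u)).card ≤ p i + 1) := by
  set i₀ : Fin s := ⟨0, by omega⟩
  have hcast : G.maxDegree ≤ ∑ i, (p i + 1) := by
    rw [Finset.sum_add_distrib]
    simp only [Finset.sum_const, Finset.card_univ, Fintype.card_fin, smul_eq_mul, mul_one]
    zify
    linarith
  have hdeg : ∀ v, BorodinBollobasManvel.degIn G v Finset.univ ≤ ∑ i, (p i + 1) := by
    intro v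
    refine (Eq.le ?_).trans ((G.degree_le_maxDegree v).trans hcast)
    rw [← G.card_neighborFinset_eq_degree, BorodinBollobasManvel.degIn, G.neighborFinset_eq_filter]
  have hsplit := Finset.add_sum_erase Finset.univ (fun i => p i + 1) (Finset.mem_univ i₀)
  obtain ⟨q, hq⟩ : ∃ q, ∑ i ∈ Finset.univ.erase i₀, (p i + 1) = q + 1 := by
    refine Nat.exists_eq_succ_of_ne_zero fun h0 => ?_
    rw [Finset.sum_eq_zero_iff] at h0
    have := h0 ⟨1, by omega⟩ (by simp [i₀])
    omega
  obtain ⟨W, hW₀, hW⟩ := BorodinBollobasManvel.exists_split (G := G) (p := p i₀) (q := q) (by omega) hconn hnc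
    (fun v => by have := hdeg v; omega)
  obtain ⟨c, hcI, hc⟩ := BorodinBollobasManvel.exists_coloring_of_degenerateOn p (Finset.univ.erase i₀) hq.ge W hW
  obtain ⟨c', hc', hdeg'⟩ := BorodinBollobasManvel.exists_coloring_degIn_le p hdeg
    ⟨fun v => if v ∈ W then c v else i₀, fun i => by
      by_cases hi : i = i₀
      · subst hi
        refine hW₀.mono fun z hz => ?_
        rw [Finset.mem_compl]
        intro hzW
        simp only [Finset.mem_filter_univ, hzW, if_true] at hz
        exact (Finset.mem_erase.1 (hcI z)).1 hz
      · refine (hc i (by simp [hi])).mono fun z hz => ?_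
        by_cases hzW : z ∈ W
        · simpa [hzW] using hz
        · simp [hzW, Ne.symm hi] at hz⟩
  refine ⟨fun i => Finset.univ.filter (c' · = i), fun v => ⟨c' v, by simp, by simp⟩, hc', ?_⟩
  intro i v hv
  rw [Finset.mem_filter_univ] at hv
  subst hv
  exact hdeg' v
end

section
/- Let Δ ≥ 3 and let H be a finite 2-connected simple graph with maximum degree at most Δ in which every vertex, except possibly a distinguished vertex v, has degree exactly Δ. Suppose H is not isomorphic to K_{Δ+1} and not isomorphic to K_*^−, the graph obtained from K_{Δ+1} by subdividing exactly one edge. Then there exist a vertex z of H and a set X ⊆ N(z) of neighbors of z such that: |X| = Δ − 1; the induced subgraph H[X] is not a complete graph; the induced subgraph H − X obtained by deleting the vertices of X is connected; and v ∉ X. -/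
/-- A graph is 2-connected if it has at least 3 vertices and remains connected after
deleting any single vertex. -/
def TwoConnected {V : Type*} [Fintype V] (G : SimpleGraph V) : Prop :=
  3 ≤ Fintype.card V ∧ ∀ v : V, (G.induce {u : V | u ≠ v}).Connected

/-- The quasi-clique `K_*^-`: the graph obtained from the complete graph `K_{Δ+1}`
(on the vertices `0, …, Δ`) by subdividing exactly one edge (the edge `{0, 1}` is
replaced by the new vertex `Δ + 1`, adjacent exactly to `0` and `1`). -/
def QuasiClique (Δ : ℕ) : SimpleGraph (Fin (Δ + 2)) :=
  SimpleGraph.fromRel (fun a b =>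
    (a.val ≤ Δ ∧ b.val ≤ Δ ∧ ¬((a.val = 0 ∧ b.val = 1) ∨ (a.val = 1 ∧ b.val = 0)))
    ∨ (a.val = Δ + 1 ∧ b.val ≤ 1))

namespace SimpleGraph

variable {V : Type*} {H : SimpleGraph V}

theorem Connected.subset_of_closed {S T : Set V} (h : (H.induce S).Connected) {r : V}
    (hrS : r ∈ S) (hrT : r ∈ T) (hT : ∀ x ∈ T, x ∈ S → ∀ y ∈ S, H.Adj x y → y ∈ T) :
    S ⊆ T := by
  intro y hy
  obtain ⟨p⟩ := h.preconnected ⟨r, hrS⟩ ⟨y, hy⟩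
  suffices key : ∀ (a b : S), (H.induce S).Walk a b → (a : V) ∈ T → (b : V) ∈ T from
    key _ _ p hrT
  intro a b p
  induction p with
  | nil => exact id
  | cons hab _ ih => exact fun ha => ih (hT _ ha (Subtype.prop _) _ (Subtype.prop _) hab)

theorem connected_induce_of_closed {S : Set V} {r : V} (hr : r ∈ S)
    (h : ∀ T : Set V, r ∈ T → (∀ x ∈ T, ∀ y ∈ S, H.Adj x y → y ∈ T) → S ⊆ T) :
    (H.induce S).Connected := by
  rw [connected_iff_exists_forall_reachable]
  refine ⟨⟨r, hr⟩, fun w => ?_⟩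
  have := h {y | ∃ hy : y ∈ S, (H.induce S).Reachable ⟨r, hr⟩ ⟨y, hy⟩}
    ⟨hr, Reachable.refl _⟩ (by
      rintro x ⟨hx, hrx⟩ y hy hxy
      have hadj : (H.induce S).Adj ⟨x, hx⟩ ⟨y, hy⟩ := hxy
      exact ⟨hy, hrx.trans hadj.reachable⟩) w.2
  exact this.2

/-- The vertices reachable from `v` by walks avoiding the closed neighborhood of `z`. -/
def farComponent (H : SimpleGraph V) (v z : V) : Set V :=
  {u | Relation.ReflTransGen (fun a b => H.Adj a b ∧ b ≠ z ∧ ¬ H.Adj z b) v u}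

theorem mem_farComponent_self (v z : V) : v ∈ H.farComponent v z := Relation.ReflTransGen.refl

theorem mem_farComponent_of_adj {v z a b : V} (ha : a ∈ H.farComponent v z) (hab : H.Adj a b)
    (hbz : b ≠ z) (hzb : ¬ H.Adj z b) : b ∈ H.farComponent v z :=
  Relation.ReflTransGen.tail ha ⟨hab, hbz, hzb⟩

theorem farComponent_subset_of_closed {v z : V} {T : Set V} (hv : v ∈ T)
    (hT : ∀ a ∈ H.farComponent v z, a ∈ T → ∀ b ∈ H.farComponent v z, H.Adj a b → b ∈ T) :
    H.farComponent v z ⊆ T := by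
  intro u hu
  induction hu with
  | refl => exact hv
  | tail h hbc ih => exact hT _ h ih _ (h.tail hbc) hbc.1

theorem not_near_of_mem_farComponent {v z : V} (hvz : v ≠ z) (hzv : ¬ H.Adj z v) {u : V}
    (hu : u ∈ H.farComponent v z) : u ≠ z ∧ ¬ H.Adj z u := by
  rcases Relation.ReflTransGen.cases_tail hu with h | ⟨_, _, h⟩
  · exact h ▸ ⟨hvz, hzv⟩
  · exact h.2

theorem exists_adj_farComponent {v z : V} (hvz : v ≠ z) (hzv : ¬ H.Adj z v) {a : V}
    (ha : H.Adj z a) (hconn : (H.induce {u | u ≠ a}).Connected) :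
    ∃ b, H.Adj z b ∧ b ≠ a ∧ ∃ c ∈ H.farComponent v z, H.Adj b c := by
  by_contra! hcon
  have hva : v ≠ a := by rintro rfl; exact hzv ha
  have := hconn.subset_of_closed (T := H.farComponent v z) hva (mem_farComponent_self v z)
    (by
      intro x hx _ y hya hxy
      have hx' := not_near_of_mem_farComponent hvz hzv hx
      refine mem_farComponent_of_adj hx hxy ?_ fun hzy => hcon y hzy hya x hx hxy.symm
      rintro rfl
      exact hx'.2 hxy.symm) ha.ne
  exact (not_near_of_mem_farComponent hvz hzv this).1 rfl

theorem adj_of_maximal_farComponent [Finite V] {v z : V} (hvz : v ≠ z) (hzv : ¬ H.Adj z v)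
    (hmax : ∀ u, v ≠ u → ¬ H.Adj u v →
      (H.farComponent v u).ncard ≤ (H.farComponent v z).ncard)
    {w c u : V} (hzw : H.Adj z w) (hc : c ∈ H.farComponent v z) (hwc : H.Adj w c)
    (huz : u ≠ z) (hzu : ¬ H.Adj z u) (hu : u ∉ H.farComponent v z) : H.Adj w u := by
  by_contra hwu
  have hfar : ∀ a ∈ H.farComponent v z, ¬ H.Adj u a := fun a ha h =>
    hu (mem_farComponent_of_adj ha h.symm huz hzu)
  have hvu : v ≠ u := by rintro rfl; exact hu (mem_farComponent_self _ _)
  have hsub : H.farComponent v z ⊆ H.farComponent v u :=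
    farComponent_subset_of_closed (mem_farComponent_self _ _) fun a _ ha b hb hab =>
      mem_farComponent_of_adj ha hab (by rintro rfl; exact hu hb) (hfar b hb)
  have hw : w ∈ H.farComponent v u :=
    mem_farComponent_of_adj (hsub hc) hwc.symm (by rintro rfl; exact hzu hzw)
      fun h => hwu h.symm
  have hss : H.farComponent v z ⊂ H.farComponent v u :=
    (Set.ssubset_iff_of_subset hsub).2
      ⟨w, hw, fun h => (not_near_of_mem_farComponent hvz hzv h).2 hzw⟩
  exact absurd (hmax u hvu (hfar v (mem_farComponent_self _ _)))
    (not_le.2 (Set.ncard_lt_ncard hss (Set.toFinite _)))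

theorem connected_induce_compl_neighbors {v z w c : V} (hvz : v ≠ z) (hzv : ¬ H.Adj z v)
    (hzw : H.Adj z w) (hc : c ∈ H.farComponent v z) (hwc : H.Adj w c)
    (hrest : ∀ u, u ≠ z → ¬ H.Adj z u → u ∉ H.farComponent v z → H.Adj w u) :
    (H.induce {u | H.Adj z u → u = w}).Connected := by
  refine connected_induce_of_closed (r := w) (fun _ => rfl) fun T hwT hT y hy => ?_
  have hfar : ∀ a ∈ H.farComponent v z, a ∈ {u | H.Adj z u → u = w} := fun a ha h =>
    absurd h (not_near_of_mem_farComponent hvz hzv ha).2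
  have hvT : v ∈ T := by
    by_contra hvT
    exact farComponent_subset_of_closed (T := Tᶜ) hvT
      (fun a ha haT b _ hab hb => haT (hT b hb a (hfar a ha) hab.symm)) hc
      (hT w hwT c (hfar c hc) hwc)
  have hCT : H.farComponent v z ⊆ T :=
    farComponent_subset_of_closed hvT fun a _ haT b hb hab => hT a haT b (hfar b hb) hab
  by_cases hyz : y = z
  · subst hyz
    exact hT w hwT _ hy hzw.symm
  by_cases hzy : H.Adj z y
  · exact hy hzy ▸ hwT
  by_cases hyC : y ∈ H.farComponent v z
  · exact hCT hyC
  · exact hT w hwT y hy (hrest y hyz hzy hyC)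

/-- The closed neighborhood of `z` induces a complete graph minus the edge `w₁w₂`, and its only
edges to the outside are `w₁c₁` and `w₂c₂`. -/
structure IsPendantQuasiClique (H : SimpleGraph V) (z w₁ w₂ c₁ c₂ : V) : Prop where
  adj_left : H.Adj z w₁
  adj_right : H.Adj z w₂
  ne : w₁ ≠ w₂
  left_ne : c₁ ≠ z
  left_not_adj : ¬ H.Adj z c₁
  right_ne : c₂ ≠ z
  right_not_adj : ¬ H.Adj z c₂
  adj_left_iff : ∀ y, H.Adj w₁ y ↔ y = z ∨ y = c₁ ∨ (H.Adj z y ∧ y ≠ w₁ ∧ y ≠ w₂)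
  adj_right_iff : ∀ y, H.Adj w₂ y ↔ y = z ∨ y = c₂ ∨ (H.Adj z y ∧ y ≠ w₁ ∧ y ≠ w₂)
  adj_iff : ∀ x, H.Adj z x → x ≠ w₁ → x ≠ w₂ → ∀ y, H.Adj x y ↔ y ≠ x ∧ (y = z ∨ H.Adj z y)

namespace IsPendantQuasiClique

variable {z w₁ w₂ c₁ c₂ : V}

theorem symm (h : H.IsPendantQuasiClique z w₁ w₂ c₁ c₂) :
    H.IsPendantQuasiClique z w₂ w₁ c₂ c₁ where
  adj_left := h.adj_right
  adj_right := h.adj_left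
  ne := h.ne.symm
  left_ne := h.right_ne
  left_not_adj := h.right_not_adj
  right_ne := h.left_ne
  right_not_adj := h.left_not_adj
  adj_left_iff y := by rw [h.adj_right_iff]; tauto
  adj_right_iff y := by rw [h.adj_left_iff]; tauto
  adj_iff x hx h₁ h₂ := h.adj_iff x hx h₂ h₁

theorem eq_or_eq_of_adj (h : H.IsPendantQuasiClique z w₁ w₂ c₁ c₂) {x y : V}
    (hx : x = z ∨ H.Adj z x) (hyz : y ≠ z) (hzy : ¬ H.Adj z y) (hxy : H.Adj x y) :
    (x = w₁ ∧ y = c₁) ∨ (x = w₂ ∧ y = c₂) := by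
  rcases hx with rfl | hx
  · exact absurd hxy hzy
  by_cases h₁ : x = w₁
  · subst h₁
    have := (h.adj_left_iff y).1 hxy
    tauto
  by_cases h₂ : x = w₂
  · subst h₂
    have := (h.adj_right_iff y).1 hxy
    tauto
  · have := (h.adj_iff x hx h₁ h₂ y).1 hxy
    tauto

theorem connected_induce (h : H.IsPendantQuasiClique z w₁ w₂ c₁ c₂)
    (hconn : (H.induce {u | u ≠ c₁}).Connected) (hc : c₂ ≠ c₁) :
    (H.induce {u | H.Adj w₁ u → u = z}).Connected := by
  have hw₂ : w₂ ∈ {u | H.Adj w₁ u → u = z} := by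
    intro h'
    have := (h.adj_left_iff _).1 h'
    rcases this with h' | rfl | h'
    · exact h'
    · exact absurd h.adj_right h.left_not_adj
    · exact absurd rfl h'.2.2
  refine connected_induce_of_closed hw₂ fun T hwT hT y hy => ?_
  have hout : ∀ u, u ≠ c₁ → ¬ H.Adj z u → u ∈ {u | H.Adj w₁ u → u = z} := by
    intro u hu hzu h'
    have := (h.adj_left_iff _).1 h'
    tauto
  have hzT : z ∈ T := hT _ hwT z (fun _ => rfl) h.adj_right.symm
  have hw₁T : w₁ ∈ T := hT _ hzT w₁ (fun h' => absurd rfl h'.ne) h.adj_left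
  have hsub := hconn.subset_of_closed (T := {u | u = z ∨ H.Adj z u} ∪ T) h.left_ne.symm
    (Or.inl (Or.inl rfl)) (by
      intro x hx _ y hyc hxy
      by_cases hyN : y = z ∨ H.Adj z y
      · exact Or.inl hyN
      right
      rw [not_or] at hyN
      rcases hx with hx | hx
      · rcases h.eq_or_eq_of_adj hx hyN.1 hyN.2 hxy with ⟨_, h'⟩ | ⟨rfl, rfl⟩
        · exact absurd h' hyc
        · exact hT _ hwT _ (hout _ hyc hyN.2) hxy
      · exact hT _ hx _ (hout _ hyc hyN.2) hxy)
  have hyc : y ≠ c₁ := by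
    rintro rfl
    exact h.left_ne (hy ((h.adj_left_iff _).2 (Or.inr (Or.inl rfl))))
  rcases hsub hyc with (hyz | hzy) | hyT
  · exact hyz ▸ hzT
  · by_cases h₁ : y = w₁
    · exact h₁ ▸ hw₁T
    by_cases h₂ : y = w₂
    · exact h₂ ▸ hwT
    · exact hy ((h.adj_left_iff _).2 (Or.inr (Or.inr ⟨hzy, h₁, h₂⟩))) ▸ hzT
  · exact hyT

theorem eq_of_connected (h : H.IsPendantQuasiClique z w₁ w₂ c₁ c₂)
    (hconn : (H.induce {u | u ≠ c₁}).Connected) (hc : c₂ = c₁) (u : V) :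
    u = z ∨ H.Adj z u ∨ u = c₁ := by
  by_cases hu : u = c₁
  · exact Or.inr (Or.inr hu)
  have := hconn.subset_of_closed (T := {u | u = z ∨ H.Adj z u}) h.left_ne.symm
    (Or.inl rfl) (by
      intro x hx _ y hyc hxy
      by_contra hyN
      simp only [Set.mem_ofPred_eq, not_or] at hyN
      rcases h.eq_or_eq_of_adj hx hyN.1 hyN.2 hxy with ⟨_, h'⟩ | ⟨_, h'⟩
      · exact hyc h'
      · exact hyc (h'.trans hc)) hu
  rcases this with h' | h'
  · exact Or.inl h'
  · exact Or.inr (Or.inl h')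

theorem adj_iff_of_eq (h : H.IsPendantQuasiClique z w₁ w₂ c₁ c₁)
    (hall : ∀ u, u = z ∨ H.Adj z u ∨ u = c₁) (a b : V) :
    H.Adj a b ↔ a ≠ b ∧
      ((a ≠ c₁ ∧ b ≠ c₁ ∧ ¬ ((a = w₁ ∧ b = w₂) ∨ (a = w₂ ∧ b = w₁))) ∨
        (a = c₁ ∧ (b = w₁ ∨ b = w₂)) ∨ (b = c₁ ∧ (a = w₁ ∨ a = w₂))) := by
  have hw₁ := h.adj_left_iff
  have hw₂ := h.adj_right_iff
  have hx := h.adj_iff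
  have hl := h.adj_left
  have hr := h.adj_right
  have hne := h.ne
  have hcz := h.left_ne
  have hzc := h.left_not_adj
  have hcN : ∀ x, H.Adj c₁ x ↔ x = w₁ ∨ x = w₂ := by
    intro x
    constructor
    · intro hcx
      by_cases hxN : x = z ∨ H.Adj z x
      · exact (h.eq_or_eq_of_adj hxN hcz hzc hcx.symm).imp And.left And.left
      · have := hall x
        have := hcx.ne
        tauto
    · rintro (rfl | rfl)
      · exact ((hw₁ _).2 (by tauto)).symm
      · exact ((hw₂ _).2 (by tauto)).symm
  by_cases hab : a = b
  · simp [hab]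
  by_cases ha : a = c₁
  · subst ha
    rw [hcN]
    tauto
  by_cases hb : b = c₁
  · subst hb
    rw [H.adj_comm, hcN]
    tauto
  have hA := hall a
  have hB := hall b
  have hzw₁ := hl.ne
  have hzw₂ := hr.ne
  by_cases ha₁ : a = w₁
  · subst ha₁
    rw [hw₁]
    grind
  by_cases ha₂ : a = w₂
  · subst ha₂
    rw [hw₂]
    grind
  by_cases haz : a = z
  · subst haz
    grind
  rw [hx a (by tauto) ha₁ ha₂]
  grind

theorem nonempty_iso_quasiClique [Fintype V] {Δ : ℕ}
    (h : H.IsPendantQuasiClique z w₁ w₂ c₁ c₁) (hall : ∀ u, u = z ∨ H.Adj z u ∨ u = c₁)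
    (hcard : Fintype.card V = Δ + 2) : Nonempty (H ≃g QuasiClique Δ) := by
  classical
  have h₁ : w₁ ≠ c₁ := by rintro rfl; exact h.left_not_adj h.adj_left
  have h₂ : w₂ ≠ c₁ := by rintro rfl; exact h.left_not_adj h.adj_right
  have hΔ : 0 < Δ := by
    have hs : ({z, w₁, w₂} : Finset V).card ≤ ({c₁}ᶜ : Finset V).card :=
      Finset.card_le_card (by
        intro x hx
        have := h.left_ne
        simp only [Finset.mem_insert, Finset.mem_singleton] at hx
        simp only [Finset.mem_compl, Finset.mem_singleton]
        rcases hx with rfl | rfl | rfl <;> tauto)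
    rw [Finset.card_compl, hcard, Finset.card_singleton, Finset.card_eq_three.2
      ⟨z, w₁, w₂, h.adj_left.ne, h.adj_right.ne, h.ne, rfl⟩] at hs
    omega
  obtain ⟨e, he₁, he₂, he₃⟩ : ∃ e : V ≃ Fin (Δ + 2),
      (e w₁).val = 0 ∧ (e w₂).val = 1 ∧ (e c₁).val = Δ + 1 := by
    let f : Fin 3 → V := ![w₁, w₂, c₁]
    let g : Fin 3 → Fin (Δ + 2) := ![0, 1, Fin.last _]
    have hf : Function.Injective f := by
      have := h.ne
      intro i j hij
      fin_cases i <;> fin_cases j <;> simp_all [f]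
    have hg : Function.Injective g := by
      intro i j hij
      rw [Fin.ext_iff] at hij
      fin_cases i <;> fin_cases j <;> simp_all [g]
    obtain ⟨e₀⟩ : Nonempty (V ≃ Fin (Δ + 2)) := ⟨Fintype.equivFinOfCardEq hcard⟩
    let e₁ : Set.range (e₀ ∘ f) ≃ Set.range g :=
      (Equiv.ofInjective _ (e₀.injective.comp hf)).symm.trans (Equiv.ofInjective _ hg)
    have he : ∀ i, (e₀.trans e₁.extendSubtype) (f i) = g i := by
      intro i
      have hi := e₁.extendSubtype_apply_of_mem (e₀ (f i)) ⟨i, rfl⟩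
      simp only [Equiv.trans_apply]
      rw [hi]
      have : (⟨e₀ (f i), i, rfl⟩ : Set.range (e₀ ∘ f)) =
          Equiv.ofInjective _ (e₀.injective.comp hf) i := rfl
      simp only [e₁, Equiv.trans_apply]
      rw [this, Equiv.symm_apply_apply]
      rfl
    exact ⟨_, congrArg Fin.val (he 0), congrArg Fin.val (he 1), congrArg Fin.val (he 2)⟩
  have hval : ∀ {x y}, (e x).val = (e y).val ↔ x = y := by
    intro x y
    rw [← Fin.ext_iff, e.injective.eq_iff]
  refine ⟨e, ?_⟩
  intro a b
  rw [h.adj_iff_of_eq hall, QuasiClique, fromRel_adj, e.injective.ne_iff]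
  refine and_congr_right fun _ => ?_
  simp only [ne_eq]
  rw [← hval (x := a) (y := c₁), ← hval (x := b) (y := c₁), ← hval (x := a) (y := w₁),
    ← hval (x := a) (y := w₂), ← hval (x := b) (y := w₁), ← hval (x := b) (y := w₂),
    he₁, he₂, he₃]
  have ha := (e a).isLt
  have hb := (e b).isLt
  omega

end IsPendantQuasiClique

section Fintype

variable [Fintype V] [DecidableEq V] [DecidableRel H.Adj] {Δ : ℕ}

theorem isPendantQuasiClique_of_degree {z w₁ w₂ c₁ c₂ : V} (hmax : ∀ u, H.degree u ≤ Δ)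
    (hz : H.degree z = Δ) (hw₁ : H.Adj z w₁) (hw₂ : H.Adj z w₂) (hne : w₁ ≠ w₂)
    (hclique : ∀ w, w = w₁ ∨ w = w₂ → ∀ x y, H.Adj z x → H.Adj z y → x ≠ w → y ≠ w → x ≠ y →
      H.Adj x y)
    (hc₁z : c₁ ≠ z) (hzc₁ : ¬ H.Adj z c₁) (hc₁ : H.Adj w₁ c₁)
    (hc₂z : c₂ ≠ z) (hzc₂ : ¬ H.Adj z c₂) (hc₂ : H.Adj w₂ c₂) :
    H.IsPendantQuasiClique z w₁ w₂ c₁ c₂ := by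
  have hadj : ∀ x y, H.Adj z x → H.Adj z y → x ≠ y → ¬ (x = w₁ ∧ y = w₂) →
      ¬ (x = w₂ ∧ y = w₁) → H.Adj x y := by
    intro x y hx hy hxy h₁ h₂
    by_cases h : x ≠ w₁ ∧ y ≠ w₁
    · exact hclique w₁ (Or.inl rfl) x y hx hy h.1 h.2 hxy
    · exact hclique w₂ (Or.inr rfl) x y hx hy (by grind) (by grind) hxy
  have hN : (H.neighborFinset z).card = Δ := by rw [card_neighborFinset_eq_degree, hz]
  have hfull : ∀ (x : V) (S : Finset V), Δ ≤ S.card → (∀ y ∈ S, H.Adj x y) →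
      ∀ y, H.Adj x y ↔ y ∈ S := by
    intro x S hS hx y
    have hsub : S ⊆ H.neighborFinset x := fun y hy => (H.mem_neighborFinset x y).2 (hx y hy)
    rw [Finset.eq_of_subset_of_card_le hsub
      (by rw [card_neighborFinset_eq_degree]; exact (hmax x).trans hS), mem_neighborFinset]
  have hend : ∀ w w' c, H.Adj z w → H.Adj z w' → w ≠ w' → c ≠ z → ¬ H.Adj z c → H.Adj w c →
      (∀ x, H.Adj z x → x ≠ w → x ≠ w' → H.Adj w x) →
      ∀ y, H.Adj w y ↔ y = z ∨ y = c ∨ (H.Adj z y ∧ y ≠ w ∧ y ≠ w') := by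
    intro w w' c hw hw' hww' hcz hzc hwc hx y
    have hcard : (((H.neighborFinset z).erase w).erase w').card + 2 = Δ := by
      rw [← hN, ← Finset.card_erase_add_one (s := H.neighborFinset z) (a := w) (by simpa),
        ← Finset.card_erase_add_one (s := (H.neighborFinset z).erase w) (a := w')
          (by simpa using ⟨hww'.symm, hw'⟩)]
    rw [hfull w (insert z (insert c (((H.neighborFinset z).erase w).erase w')))]
    · simp
      tauto
    · rw [Finset.card_insert_of_notMem (by simp [hcz.symm]),
        Finset.card_insert_of_notMem (by simp [hzc])]
      omega
    · intro y hy
      simp only [Finset.mem_insert, Finset.mem_erase, mem_neighborFinset] at hy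
      rcases hy with rfl | rfl | hy
      · exact hw.symm
      · exact hwc
      · exact hx y hy.2.2 hy.2.1 hy.1
  exact
    { adj_left := hw₁
      adj_right := hw₂
      ne := hne
      left_ne := hc₁z
      left_not_adj := hzc₁
      right_ne := hc₂z
      right_not_adj := hzc₂
      adj_left_iff := hend w₁ w₂ c₁ hw₁ hw₂ hne hc₁z hzc₁ hc₁ fun x hx h₁ h₂ =>
        hadj w₁ x hw₁ hx h₁.symm (by tauto) (by tauto)
      adj_right_iff := fun y => by
        rw [hend w₂ w₁ c₂ hw₂ hw₁ hne.symm hc₂z hzc₂ hc₂ fun x hx h₁ h₂ =>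
          hadj w₂ x hw₂ hx h₁.symm (by tauto) (by tauto)]
        tauto
      adj_iff := by
        intro x hx h₁ h₂ y
        rw [hfull x (insert z ((H.neighborFinset z).erase x))]
        · have := hx.ne
          simp only [Finset.mem_insert, Finset.mem_erase, mem_neighborFinset]
          grind
        · rw [Finset.card_insert_of_notMem (by simp), Finset.card_erase_add_one (by simpa), hN]
        · intro y hy
          simp only [Finset.mem_insert, Finset.mem_erase, mem_neighborFinset] at hy
          rcases hy with rfl | hy
          · exact hx.symm
          · exact hadj x y hx hy.2 hy.1.symm (by tauto) (by tauto) }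

theorem nonempty_iso_top_of_forall_adj {v : V} (hcard : 3 ≤ Fintype.card V)
    (hmax : ∀ u, H.degree u ≤ Δ) (hdeg : ∀ u, u ≠ v → H.degree u = Δ)
    (hv : ∀ u, v ≠ u → H.Adj u v) : Nonempty (H ≃g (⊤ : SimpleGraph (Fin (Δ + 1)))) := by
  have hdv : H.degree v = Fintype.card V - 1 := by
    rw [← card_neighborFinset_eq_degree, ← Finset.card_univ,
      ← Finset.card_erase_of_mem (Finset.mem_univ v)]
    congr 1
    ext u
    simp only [mem_neighborFinset, Finset.mem_erase, Finset.mem_univ, and_true]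
    exact ⟨fun h => h.ne.symm, fun h => (hv u h.symm).symm⟩
  have hle := hmax v
  obtain ⟨u, hu⟩ := Fintype.exists_ne_of_one_lt_card (by omega) v
  have hlt := H.degree_lt_card_verts u
  rw [hdeg u hu] at hlt
  have htop : H = ⊤ := by
    ext a b
    refine ⟨fun h => h.ne, fun hab => ?_⟩
    have hda : H.degree a = Fintype.card V - 1 := by
      by_cases ha : a = v
      · rw [ha, hdv]
      · rw [hdeg a ha]; omega
    have heq := Finset.eq_of_subset_of_card_le (s := H.neighborFinset a)
      (t := Finset.univ.erase a) (fun x hx => by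
        simpa using ((H.mem_neighborFinset a x).1 hx).ne.symm) (by
        rw [card_neighborFinset_eq_degree, hda, Finset.card_erase_of_mem (Finset.mem_univ a),
          Finset.card_univ])
    rw [← mem_neighborFinset, heq]
    simpa using Ne.symm hab
  subst htop
  exact ⟨Iso.completeGraph (Fintype.equivFinOfCardEq (by omega))⟩

end Fintype

end SimpleGraph

/-- Let `Δ ≥ 3` and let `H` be a finite 2-connected graph with maximum degree at
most `Δ` in which every vertex, except possibly a distinguished vertex `v`, has
degree exactly `Δ`.  If `H` is isomorphic neither to `K_{Δ+1}` nor to the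
quasi-clique `K_*^-`, then `H` has a special neighborhood `(z, X)` avoiding `v`:
`X ⊆ N(z)`, `|X| = Δ - 1`, `H[X]` is not complete, `H - X` is connected and
`v ∉ X`. -/
theorem exists_special_neighborhood {V : Type*} [Fintype V] [DecidableEq V]
    (H : SimpleGraph V) [DecidableRel H.Adj] (Δ : ℕ) (hΔ : 3 ≤ Δ)
    (h2c : TwoConnected H) (v : V)
    (hmax : ∀ u : V, H.degree u ≤ Δ)
    (hdeg : ∀ u : V, u ≠ v → H.degree u = Δ)
    (hK : ¬ Nonempty (H ≃g (⊤ : SimpleGraph (Fin (Δ + 1)))))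
    (hQ : ¬ Nonempty (H ≃g QuasiClique Δ)) :
    ∃ (z : V) (X : Finset V),
      (∀ x ∈ X, H.Adj z x) ∧
      X.card = Δ - 1 ∧
      (∃ x ∈ X, ∃ y ∈ X, x ≠ y ∧ ¬ H.Adj x y) ∧
      (H.induce {u : V | u ∉ X}).Connected ∧
      v ∉ X := by
  by_contra hcon
  obtain ⟨h3, hconn⟩ := h2c
  have hspecial : ∀ z w, H.Adj z w → H.degree z = Δ → (H.Adj z v → v = w) →
      (H.induce {u | H.Adj z u → u = w}).Connected →
      ∀ x y, H.Adj z x → H.Adj z y → x ≠ w → y ≠ w → x ≠ y → H.Adj x y := by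
    intro z w hzw hz hvw hc x y hx hy hxw hyw hxy
    by_contra hnadj
    refine hcon ⟨z, (H.neighborFinset z).erase w, ?_, ?_, ⟨x, ?_, y, ?_, hxy, hnadj⟩, ?_, ?_⟩
    · simp
    · rw [Finset.card_erase_of_mem (by simpa), SimpleGraph.card_neighborFinset_eq_degree, hz]
    · simpa using ⟨hxw, hx⟩
    · simpa using ⟨hyw, hy⟩
    · have hset : {u | u ∉ (H.neighborFinset z).erase w} = {u | H.Adj z u → u = w} := by
        ext u
        simp
        tauto
      rwa [hset]
    · simp
      tauto
  have hex : ∃ z, v ≠ z ∧ ¬ H.Adj z v := by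
    by_contra! h
    exact hK (SimpleGraph.nonempty_iso_top_of_forall_adj h3 hmax hdeg h)
  obtain ⟨z, ⟨hvz, hzv⟩, hzmax⟩ := (Set.toFinite {z | v ≠ z ∧ ¬ H.Adj z v}).exists_maximalFor
    (fun z => (H.farComponent v z).ncard) _ hex
  have hfarmax : ∀ u, v ≠ u → ¬ H.Adj u v →
      (H.farComponent v u).ncard ≤ (H.farComponent v z).ncard := fun u h₁ h₂ =>
    (le_total _ _).elim id (hzmax ⟨h₁, h₂⟩)
  have hz : H.degree z = Δ := hdeg z hvz.symm
  obtain ⟨a, ha⟩ : ∃ a, H.Adj z a := (H.degree_pos_iff_exists_adj z).1 (by omega)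
  obtain ⟨w₁, hw₁, -, c₁, hc₁, hwc₁⟩ := SimpleGraph.exists_adj_farComponent hvz hzv ha (hconn a)
  obtain ⟨w₂, hw₂, hne, c₂, hc₂, hwc₂⟩ :=
    SimpleGraph.exists_adj_farComponent hvz hzv hw₁ (hconn w₁)
  have hclique : ∀ w c, H.Adj z w → c ∈ H.farComponent v z → H.Adj w c →
      ∀ x y, H.Adj z x → H.Adj z y → x ≠ w → y ≠ w → x ≠ y → H.Adj x y := by
    intro w c hzw hc hwc
    exact hspecial z w hzw hz (fun h => absurd h hzv)
      (SimpleGraph.connected_induce_compl_neighbors hvz hzv hzw hc hwc fun u huz hzu hu =>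
        SimpleGraph.adj_of_maximal_farComponent hvz hzv hfarmax hzw hc hwc huz hzu hu)
  have hn₁ := SimpleGraph.not_near_of_mem_farComponent hvz hzv hc₁
  have hn₂ := SimpleGraph.not_near_of_mem_farComponent hvz hzv hc₂
  have hP : H.IsPendantQuasiClique z w₁ w₂ c₁ c₂ :=
    SimpleGraph.isPendantQuasiClique_of_degree hmax hz hw₁ hw₂ hne.symm
      (by
        rintro w (rfl | rfl)
        · exact hclique _ c₁ hw₁ hc₁ hwc₁
        · exact hclique _ c₂ hw₂ hc₂ hwc₂)
      hn₁.1 hn₁.2 hwc₁ hn₂.1 hn₂.2 hwc₂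
  have hmove : ∀ w w' c c', H.IsPendantQuasiClique z w w' c c' → c' ≠ c → v = c := by
    intro w w' c c' h hcc
    by_contra hvc
    have hwv : ¬ H.Adj w v := fun hwv => by
      have := (h.adj_left_iff v).1 hwv
      tauto
    have hwne : w ≠ v := by
      rintro rfl
      exact hzv h.adj_left
    obtain ⟨x, hx⟩ : (((H.neighborFinset z).erase w).erase w').Nonempty := by
      rw [← Finset.card_pos, Finset.card_erase_of_mem (by simpa using ⟨h.ne.symm, h.adj_right⟩),
        Finset.card_erase_of_mem (by simpa using h.adj_left),
        SimpleGraph.card_neighborFinset_eq_degree, hz]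
      omega
    simp only [Finset.mem_erase, SimpleGraph.mem_neighborFinset] at hx
    have hxc := hspecial w z h.adj_left.symm (hdeg w hwne) (fun h => absurd h hwv)
      (h.connected_induce (hconn c) hcc) x c
      ((h.adj_left_iff x).2 (by tauto)) ((h.adj_left_iff c).2 (by tauto)) hx.2.2.ne.symm
      h.left_ne (by rintro rfl; exact h.left_not_adj hx.2.2)
    have := h.eq_or_eq_of_adj (Or.inr hx.2.2) h.left_ne h.left_not_adj hxc
    tauto
  by_cases hc : c₂ = c₁
  · have hall := hP.eq_of_connected (hconn c₁) hc
    subst hc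
    refine hQ (hP.nonempty_iso_quasiClique hall ?_)
    have huniv : (Finset.univ : Finset V) = insert z (insert c₂ (H.neighborFinset z)) := by
      ext u
      have := hall u
      simp
      tauto
    rw [← Finset.card_univ, huniv, Finset.card_insert_of_notMem (by simpa using hn₁.1.symm),
      Finset.card_insert_of_notMem (by simpa using hn₁.2),
      SimpleGraph.card_neighborFinset_eq_degree, hz]
  · exact hc ((hmove _ _ _ _ hP.symm (Ne.symm hc)).symm.trans (hmove _ _ _ _ hP hc))
end
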